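/- arXiv:1103.4093 — 3 statements merged into one kernel-verified Lean document; each statement's English description precedes it below -/
import Mathlib

section
/- (Artin) For n > 2, let F_n be the free group on generators x₁,…,x_n and for 1 ≤ i ≤ n−1 let σᵢ ∈ Aut(F_n) be the automorphism defined by σᵢ(xᵢ) = x_{i+1}, σᵢ(x_{i+1}) = x_{i+1}⁻¹ xᵢ x_{i+1}, and σᵢ(x_j) = x_j for j ≠ i, i+1. Then these automorphisms satisfy the Artin relations (σᵢσⱼ = σⱼσᵢ for |i−j| > 1 and σᵢσ_{i+1}σᵢ = σ_{i+1}σᵢσ_{i+1}), so they induce a homomorphism from the braid group B_n (with its Artin presentation) into Aut(F_n), and this homomorphism is injective. -/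
/-- The Artin relators of the braid group on `n` strands. -/
def braidRels (n : ℕ) : Set (FreeGroup (Fin (n - 1))) :=
  {r | (∃ i j : Fin (n - 1), 1 < ((i : ℤ) - (j : ℤ)).natAbs ∧
          r = FreeGroup.of i * FreeGroup.of j * (FreeGroup.of j * FreeGroup.of i)⁻¹) ∨
       (∃ i j : Fin (n - 1), (j : ℕ) = (i : ℕ) + 1 ∧
          r = FreeGroup.of i * FreeGroup.of j * FreeGroup.of i *
            (FreeGroup.of j * FreeGroup.of i * FreeGroup.of j)⁻¹)}

/-- The braid group on `n` strands, given by the Artin presentation. -/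
def BraidGroup (n : ℕ) : Type :=
  PresentedGroup (braidRels n)

instance (n : ℕ) : Group (BraidGroup n) := by
  unfold BraidGroup; infer_instance

lemma FreeGroup.mulAut_ext {ι : Type*} {f g : MulAut (FreeGroup ι)}
    (h : ∀ j, f (FreeGroup.of j) = g (FreeGroup.of j)) : f = g := by
  have : f.toMonoidHom = g.toMonoidHom := FreeGroup.ext_hom _ _ h
  exact MulEquiv.toMonoidHom_injective this

section ArtinAutomorphism

variable {ι : Type*} [DecidableEq ι]

/-- The endomorphism of a free group with `x_a ↦ x_b` and `x_b ↦ x_b⁻¹ x_a x_b`, fixing the other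
generators. -/
def artinHom (a b : ι) : FreeGroup ι →* FreeGroup ι :=
  FreeGroup.lift fun j =>
    if j = a then FreeGroup.of b
    else if j = b then (FreeGroup.of b)⁻¹ * FreeGroup.of a * FreeGroup.of b
    else FreeGroup.of j

/-- The inverse of `artinHom a b`. -/
def artinInvHom (a b : ι) : FreeGroup ι →* FreeGroup ι :=
  FreeGroup.lift fun j =>
    if j = a then FreeGroup.of a * FreeGroup.of b * (FreeGroup.of a)⁻¹
    else if j = b then FreeGroup.of a
    else FreeGroup.of j

/-- The Artin automorphism of a free group attached to two distinct generators. -/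
def artinAut {a b : ι} (hab : a ≠ b) : MulAut (FreeGroup ι) :=
  (artinHom a b).toMulEquiv (artinInvHom a b)
    (by
      ext j
      by_cases hja : j = a
      · simp [artinHom, artinInvHom, hja, hab.symm]
      by_cases hjb : j = b
      · simp [artinHom, artinInvHom, hjb, hab.symm, mul_assoc]
      simp [artinHom, artinInvHom, hja, hjb])
    (by
      ext j
      by_cases hja : j = a
      · simp [artinHom, artinInvHom, hja, hab.symm, mul_assoc]
      by_cases hjb : j = b
      · simp [artinHom, artinInvHom, hjb, hab.symm]
      simp [artinHom, artinInvHom, hja, hjb])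

@[simp]
lemma artinAut_of_left {a b : ι} (hab : a ≠ b) :
    artinAut hab (FreeGroup.of a) = FreeGroup.of b := by
  simp [artinAut, artinHom]

@[simp]
lemma artinAut_of_right {a b : ι} (hab : a ≠ b) :
    artinAut hab (FreeGroup.of b) = (FreeGroup.of b)⁻¹ * FreeGroup.of a * FreeGroup.of b := by
  simp [artinAut, artinHom, hab.symm]

lemma artinAut_of_ne {a b j : ι} (hab : a ≠ b) (ha : j ≠ a) (hb : j ≠ b) :
    artinAut hab (FreeGroup.of j) = FreeGroup.of j := by
  simp [artinAut, artinHom, ha, hb]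

lemma artinAut_commute {a b c d : ι} (hab : a ≠ b) (hcd : c ≠ d) (hac : a ≠ c) (had : a ≠ d)
    (hbc : b ≠ c) (hbd : b ≠ d) :
    artinAut hab * artinAut hcd = artinAut hcd * artinAut hab := by
  apply FreeGroup.mulAut_ext
  intro j
  simp only [MulAut.mul_apply]
  have h1 := artinAut_of_ne hcd hac had
  have h2 := artinAut_of_ne hcd hbc hbd
  have h3 := artinAut_of_ne hab hac.symm hbc.symm
  have h4 := artinAut_of_ne hab had.symm hbd.symm
  by_cases ha : j = a
  · subst ha; simp [h1, h2]
  by_cases hb : j = b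
  · subst hb; simp [h1, h2]
  by_cases hc : j = c
  · subst hc; simp [h3, h4]
  by_cases hd : j = d
  · subst hd; simp [h3, h4]
  simp [artinAut_of_ne, *]

lemma artinAut_braid {a b c : ι} (hab : a ≠ b) (hbc : b ≠ c) (hac : a ≠ c) :
    artinAut hab * artinAut hbc * artinAut hab = artinAut hbc * artinAut hab * artinAut hbc := by
  apply FreeGroup.mulAut_ext
  intro j
  simp only [MulAut.mul_apply]
  have h1 := artinAut_of_ne hbc hab hac
  have h2 := artinAut_of_ne hab hac.symm hbc.symm
  by_cases ha : j = a
  · subst ha; simp [h1, h2]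
  by_cases hb : j = b
  · subst hb; simp [h1, h2]
  by_cases hc : j = c
  · subst hc; simp [h1, h2, mul_assoc]
  simp [artinAut_of_ne, *]

end ArtinAutomorphism

/-- The elements `s 0, …, s (n - 1)` of a group satisfy the Artin relations. -/
structure ArtinRelations {G : Type*} [Group G] (s : ℕ → G) (n : ℕ) : Prop where
  comm : ∀ i j, i + 1 < j → j < n → s i * s j = s j * s i
  braid : ∀ i, i + 1 < n → s i * s (i + 1) * s i = s (i + 1) * s i * s (i + 1)

/-- The automorphism `σᵢ` of the free group on countably many generators. -/
def sigma (i : ℕ) : MulAut (FreeGroup ℕ) :=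
  artinAut (Nat.ne_of_lt (Nat.lt_succ_self i))

lemma sigma_left (i : ℕ) : sigma i (FreeGroup.of i) = FreeGroup.of (i + 1) :=
  artinAut_of_left _

lemma sigma_right (i : ℕ) :
    sigma i (FreeGroup.of (i + 1)) =
      (FreeGroup.of (i + 1))⁻¹ * FreeGroup.of i * FreeGroup.of (i + 1) :=
  artinAut_of_right _

lemma sigma_of_ne {i j : ℕ} (h : j ≠ i) (h' : j ≠ i + 1) :
    sigma i (FreeGroup.of j) = FreeGroup.of j :=
  artinAut_of_ne _ h h'

lemma artinRelations_sigma (n : ℕ) : ArtinRelations sigma n where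
  comm i j hij _ := artinAut_commute _ _ (by omega) (by omega) (by omega) (by omega)
  braid i _ := artinAut_braid _ _ (by omega)

section Combing

variable {G : Type*} [Group G] {s : ℕ → G} {n : ℕ}

/-- The product `s (k + d - 1) ⋯ s (k + 1) s k`. -/
def descendingProd (s : ℕ → G) : ℕ → ℕ → G
  | _, 0 => 1
  | k, d + 1 => descendingProd s (k + 1) d * s k

/-- The coset representative `s (n - 1) ⋯ s (k + 1) s k`. -/
def cosetRep (s : ℕ → G) (n k : ℕ) : G := descendingProd s k (n - k)

lemma cosetRep_self (s : ℕ → G) (n : ℕ) : cosetRep s n n = 1 := by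
  simp [cosetRep, descendingProd]

lemma cosetRep_of_lt (s : ℕ → G) {n k : ℕ} (h : k < n) :
    cosetRep s n k = cosetRep s n (k + 1) * s k := by
  obtain ⟨d, rfl⟩ := Nat.exists_eq_add_of_lt h
  simp [cosetRep, show k + d + 1 - k = d + 1 by omega, show k + d + 1 - (k + 1) = d by omega,
    descendingProd]

lemma ArtinRelations.commute_cosetRep (hs : ArtinRelations s n) {i k : ℕ} (hik : i + 1 < k)
    (hk : k ≤ n) : Commute (s i) (cosetRep s n k) := by
  revert hik
  induction hk using Nat.decreasingInduction with
  | self => intro _; rw [cosetRep_self]; exact Commute.one_right _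
  | of_succ k hk ih =>
    intro hik
    rw [cosetRep_of_lt s hk]
    exact (ih (by omega)).mul_right (hs.comm i k hik hk)

lemma ArtinRelations.cosetRep_mul (hs : ArtinRelations s n) {i k : ℕ} (hki : k ≤ i)
    (hi : i + 1 < n) : cosetRep s n k * s (i + 1) = s i * cosetRep s n k := by
  induction hki using Nat.decreasingInduction with
  | self =>
    rw [cosetRep_of_lt s (show i < n by omega), cosetRep_of_lt s hi]
    have h := (hs.commute_cosetRep (i := i) (k := i + 2) (by omega) (by omega)).eq
    have hb := hs.braid i hi
    simp only [← mul_assoc]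
    rw [show i + 1 + 1 = i + 2 from rfl, h]
    simp only [mul_assoc] at hb ⊢
    rw [hb]
  | of_succ k hk ih =>
    rw [cosetRep_of_lt s (show k < n by omega), mul_assoc,
      hs.comm k (i + 1) (by omega) hi, ← mul_assoc, ih, mul_assoc]

/-- The pure braid in which the `k`-th strand makes a full turn around the last one. -/
def pureGen (s : ℕ → G) (n k : ℕ) : G :=
  if k < n then cosetRep s n (k + 1) * (s k * s k) * (cosetRep s n (k + 1))⁻¹ else 1

lemma pureGen_of_lt (s : ℕ → G) {n k : ℕ} (h : k < n) :
    pureGen s n k = cosetRep s n (k + 1) * (s k * s k) * (cosetRep s n (k + 1))⁻¹ :=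
  if_pos h

lemma pureGen_of_le (s : ℕ → G) {n k : ℕ} (h : n ≤ k) : pureGen s n k = 1 :=
  if_neg (by omega)

lemma ArtinRelations.commute_pureGen (hs : ArtinRelations s n) {i k : ℕ} (hi : i + 1 < n)
    (h1 : k ≠ i) (h2 : k ≠ i + 1) : Commute (s i) (pureGen s n k) := by
  by_cases hk : k < n
  · rw [pureGen_of_lt s hk]
    rcases lt_or_gt_of_ne h1 with h | h
    · have h3 := hs.cosetRep_mul (i := i) (k := k + 1) (by omega) hi
      have h4 : Commute (s (i + 1)) (s k * s k) :=
        Commute.mul_right (hs.comm k (i + 1) (by omega) hi).symm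
          (hs.comm k (i + 1) (by omega) hi).symm
      have h5 : s i = cosetRep s n (k + 1) * s (i + 1) * (cosetRep s n (k + 1))⁻¹ := by
        rw [h3, mul_inv_cancel_right]
      rw [h5]
      exact (Commute.conj_iff _).2 h4
    · have h3 := hs.commute_cosetRep (i := i) (k := k + 1) (by omega) (by omega)
      have h4 : Commute (s i) (s k) := hs.comm i k (by omega) hk
      exact (h3.mul_right (h4.mul_right h4)).mul_right h3.inv_right
  · rw [pureGen_of_le s (by omega)]
    exact Commute.one_right _

lemma ArtinRelations.conj_pureGen (hs : ArtinRelations s n) {i : ℕ} (hi : i + 1 < n) :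
    s i * pureGen s n i * (s i)⁻¹ = pureGen s n (i + 1) := by
  rw [pureGen_of_lt s hi, pureGen_of_lt s (by omega : i < n), cosetRep_of_lt s hi]
  have hc := (hs.commute_cosetRep (i := i) (k := i + 2) (by omega) (by omega)).eq
  have hb := hs.braid i hi
  rw [show i + 1 + 1 = i + 2 from rfl]
  generalize cosetRep s n (i + 2) = c at *
  generalize s i = x at *
  generalize s (i + 1) = y at *
  rw [mul_inv_eq_iff_eq_mul]
  calc x * (c * y * (x * x) * (c * y)⁻¹)
      = (x * c) * y * x * x * y⁻¹ * c⁻¹ := by group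
    _ = c * (x * y * x) * x * y⁻¹ * c⁻¹ := by rw [hc]; group
    _ = c * (y * x * y) * x * y⁻¹ * c⁻¹ := by rw [hb]
    _ = c * y * (x * y * x) * y⁻¹ * c⁻¹ := by group
    _ = c * (y * y) * x * c⁻¹ := by rw [hb]; group
    _ = c * (y * y) * c⁻¹ * (c * x) * c⁻¹ := by group
    _ = c * (y * y) * c⁻¹ * x := by rw [← hc]; group

lemma ArtinRelations.commute_pureGen_mul_pureGen (hs : ArtinRelations s n) {i : ℕ}
    (hi : i + 1 < n) : Commute (s i) (pureGen s n i * pureGen s n (i + 1)) := by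
  rw [pureGen_of_lt s hi, pureGen_of_lt s (by omega : i < n), cosetRep_of_lt s hi]
  have hc := hs.commute_cosetRep (i := i) (k := i + 2) (by omega) (by omega)
  have hb := hs.braid i hi
  rw [show i + 1 + 1 = i + 2 from rfl]
  generalize cosetRep s n (i + 2) = c at *
  generalize s i = x at *
  generalize s (i + 1) = y at *
  have h : Commute x (y * x * x * y) := by
    change x * (y * x * x * y) = y * x * x * y * x
    calc x * (y * x * x * y) = (x * y * x) * (x * y) := by group
      _ = y * x * (y * x * y) := by rw [hb]; group
      _ = y * x * x * y * x := by rw [← hb]; group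
  have e : c * y * (x * x) * (c * y)⁻¹ * (c * (y * y) * c⁻¹) = c * (y * x * x * y) * c⁻¹ := by
    group
  rw [e]
  exact (hc.mul_right h).mul_right hc.inv_right

lemma ArtinRelations.conj_pureGen_succ (hs : ArtinRelations s n) {i : ℕ} (hi : i + 1 < n) :
    s i * pureGen s n (i + 1) * (s i)⁻¹ =
      (pureGen s n (i + 1))⁻¹ * pureGen s n i * pureGen s n (i + 1) := by
  have h1 := hs.conj_pureGen hi
  have h2 := (hs.commute_pureGen_mul_pureGen hi).eq
  generalize pureGen s n (i + 1) = b at *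
  generalize pureGen s n i = a at *
  generalize s i = x at *
  rw [mul_inv_eq_iff_eq_mul, mul_assoc, mul_assoc, eq_inv_mul_iff_mul_eq, ← mul_assoc a, ← h2,
    ← h1]
  group

/-- The homomorphism from the free group sending `x_k` to `pureGen s n k`. -/
def pureHom (s : ℕ → G) (n : ℕ) : FreeGroup ℕ →* G := FreeGroup.lift (pureGen s n)

@[simp]
lemma pureHom_of (s : ℕ → G) (n k : ℕ) : pureHom s n (FreeGroup.of k) = pureGen s n k := by
  simp [pureHom]

lemma ArtinRelations.conj_pureHom (hs : ArtinRelations s n) {i : ℕ} (hi : i + 1 < n)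
    (f : FreeGroup ℕ) : s i * pureHom s n f * (s i)⁻¹ = pureHom s n (sigma i f) := by
  suffices h : (MulAut.conj (s i)).toMonoidHom.comp (pureHom s n) =
      (pureHom s n).comp (sigma i).toMonoidHom by
    simpa using DFunLike.congr_fun h f
  ext k
  by_cases h1 : k = i
  · subst h1
    simpa [sigma_left] using hs.conj_pureGen hi
  by_cases h2 : k = i + 1
  · subst h2
    simpa [sigma_right] using hs.conj_pureGen_succ hi
  simpa [sigma_of_ne h1 h2, mul_inv_eq_iff_eq_mul] using (hs.commute_pureGen hi h1 h2).eq

end Combing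

section Presentation

/-- The Artin generator `σᵢ` of the braid group, indexed by natural numbers. -/
def braidGen (n i : ℕ) : PresentedGroup (braidRels n) :=
  if h : i < n - 1 then PresentedGroup.of ⟨i, h⟩ else 1

lemma braidGen_of_lt {n i : ℕ} (h : i < n - 1) :
    braidGen n i = PresentedGroup.of ⟨i, h⟩ := dif_pos h

lemma artinRelations_braidGen (n : ℕ) : ArtinRelations (braidGen n) (n - 1) where
  comm i j hij hj := by
    rw [braidGen_of_lt hj, braidGen_of_lt (by omega : i < n - 1), ← mul_inv_eq_one]
    refine PresentedGroup.one_of_mem (rels := braidRels n) (Or.inl ⟨⟨i, by omega⟩, ⟨j, hj⟩, ?_, rfl⟩)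
    simp only
    omega
  braid i hi := by
    rw [braidGen_of_lt hi, braidGen_of_lt (by omega : i < n - 1), ← mul_inv_eq_one]
    exact PresentedGroup.one_of_mem (rels := braidRels n)
      (Or.inr ⟨⟨i, by omega⟩, ⟨i + 1, hi⟩, rfl, rfl⟩)

lemma braidRels_lift_eq_one {G : Type*} [Group G] {n : ℕ} {s : Fin (n - 1) → G}
    (hc : ∀ i j : Fin (n - 1), (i : ℕ) + 1 < j → s i * s j = s j * s i)
    (hb : ∀ i j : Fin (n - 1), (j : ℕ) = i + 1 → s i * s j * s i = s j * s i * s j) :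
    ∀ r ∈ braidRels n, FreeGroup.lift s r = 1 := by
  rintro r (⟨i, j, hij, rfl⟩ | ⟨i, j, hij, rfl⟩)
  · simp only [map_mul, map_inv, FreeGroup.lift_apply_of, mul_inv_eq_one]
    rcases lt_or_ge (i : ℕ) j with h | h
    · exact hc i j (by omega)
    · exact (hc j i (by omega)).symm
  · simp only [map_mul, map_inv, FreeGroup.lift_apply_of, mul_inv_eq_one]
    exact hb i j hij

/-- The homomorphism from the braid group given by elements satisfying the Artin relations. -/
def ArtinRelations.toHom {G : Type*} [Group G] {n : ℕ} {s : ℕ → G}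
    (hs : ArtinRelations s (n - 1)) : PresentedGroup (braidRels n) →* G :=
  PresentedGroup.toGroup (rels := braidRels n) (f := fun i : Fin (n - 1) => s i)
    (braidRels_lift_eq_one (fun i j hij => hs.comm i j hij j.isLt)
      fun i j hij => by
        have := hs.braid i (by omega)
        rwa [← hij] at this)

lemma ArtinRelations.toHom_braidGen {G : Type*} [Group G] {n : ℕ} {s : ℕ → G}
    (hs : ArtinRelations s (n - 1)) {i : ℕ} (hi : i < n - 1) : hs.toHom (braidGen n i) = s i := by
  rw [braidGen_of_lt hi]
  exact PresentedGroup.toGroup.of (rels := braidRels n) _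

lemma closure_braidGen (n : ℕ) :
    Subgroup.closure {g | ∃ i < n - 1, braidGen n i = g} = ⊤ := by
  rw [← PresentedGroup.closure_range_of (braidRels n)]
  congr 1
  ext g
  constructor
  · rintro ⟨i, hi, rfl⟩
    exact ⟨⟨i, hi⟩, (braidGen_of_lt hi).symm⟩
  · rintro ⟨i, rfl⟩
    exact ⟨i, i.isLt, braidGen_of_lt i.isLt⟩

@[elab_as_elim]
lemma braid_induction {n : ℕ} {p : PresentedGroup (braidRels n) → Prop} (h1 : p 1)
    (hmul : ∀ g, ∀ i < n - 1, p g → p (g * braidGen n i))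
    (hinv : ∀ g, ∀ i < n - 1, p g → p (g * (braidGen n i)⁻¹)) (g : PresentedGroup (braidRels n)) :
    p g := by
  have hg : g ∈ Subgroup.closure {g | ∃ i < n - 1, braidGen n i = g} := by
    rw [closure_braidGen]; trivial
  induction hg using Subgroup.closure_induction_right with
  | one => exact h1
  | mul_right x _ y hy ih =>
    obtain ⟨i, hi, rfl⟩ := hy
    exact hmul x i hi ih
  | mul_inv_cancel x _ y hy ih =>
    obtain ⟨i, hi, rfl⟩ := hy
    exact hinv x i hi ih

end Presentation

section Faithfulness

/-- The action of the braid group on the free group on countably many generators. -/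
def braidAction (n : ℕ) : PresentedGroup (braidRels n) →* MulAut (FreeGroup ℕ) :=
  (artinRelations_sigma (n - 1)).toHom

lemma braidAction_braidGen {n i : ℕ} (hi : i < n - 1) : braidAction n (braidGen n i) = sigma i :=
  ArtinRelations.toHom_braidGen _ hi

/-- The inclusion of the braid group on `n` strands into the one on `n + 1` strands. -/
def braidSucc (n : ℕ) : PresentedGroup (braidRels n) →* PresentedGroup (braidRels (n + 1)) :=
  ArtinRelations.toHom (s := braidGen (n + 1))
    { comm := fun i j hij hj => (artinRelations_braidGen (n + 1)).comm i j hij (by omega)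
      braid := fun i hi => (artinRelations_braidGen (n + 1)).braid i (by omega) }

lemma braidSucc_braidGen {n i : ℕ} (hi : i < n - 1) :
    braidSucc n (braidGen n i) = braidGen (n + 1) i :=
  ArtinRelations.toHom_braidGen _ hi

lemma braidAction_braidSucc (n : ℕ) (g : PresentedGroup (braidRels n)) :
    braidAction (n + 1) (braidSucc n g) = braidAction n g := by
  induction g using braid_induction with
  | h1 => simp
  | hmul g i hi ih =>
    rw [map_mul, map_mul, map_mul, ih, braidSucc_braidGen hi, braidAction_braidGen hi,
      braidAction_braidGen (by omega)]
  | hinv g i hi ih =>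
    rw [map_mul, map_mul, map_mul, ih, map_inv, map_inv, map_inv, braidSucc_braidGen hi,
      braidAction_braidGen hi, braidAction_braidGen (by omega)]

/-- Braids on the first `n` strands conjugate the pure generators through their action on the free
group. -/
lemma conj_pureHom_braidSucc (n : ℕ) (g : PresentedGroup (braidRels n)) (f : FreeGroup ℕ) :
    braidSucc n g * pureHom (braidGen (n + 1)) n f * (braidSucc n g)⁻¹ =
      pureHom (braidGen (n + 1)) n (braidAction n g f) := by
  have hs : ArtinRelations (braidGen (n + 1)) n := artinRelations_braidGen (n + 1)
  induction g using braid_induction generalizing f with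
  | h1 => simp
  | hmul g i hi ih =>
    rw [map_mul, map_mul, MulAut.mul_apply, ← ih, braidAction_braidGen hi,
      ← hs.conj_pureHom (by omega), braidSucc_braidGen hi]
    group
  | hinv g i hi ih =>
    rw [map_mul, map_mul, MulAut.mul_apply, ← ih, map_inv, map_inv, braidAction_braidGen hi,
      braidSucc_braidGen hi]
    have := hs.conj_pureHom (i := i) (by omega) ((sigma i)⁻¹ f)
    rw [MulAut.apply_inv_self] at this
    rw [← this]
    group

lemma exists_eq_pureHom_mul_braidSucc_mul (n : ℕ) (g : PresentedGroup (braidRels (n + 1))) :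
    ∃ f b k, k ≤ n ∧
      g = pureHom (braidGen (n + 1)) n f * braidSucc n b * cosetRep (braidGen (n + 1)) n k := by
  have hs : ArtinRelations (braidGen (n + 1)) n := artinRelations_braidGen (n + 1)
  have hmove (f : FreeGroup ℕ) (b : PresentedGroup (braidRels n)) (f' : FreeGroup ℕ) :
      pureHom (braidGen (n + 1)) n f * braidSucc n b * pureHom (braidGen (n + 1)) n f' =
        pureHom (braidGen (n + 1)) n (f * braidAction n b f') * braidSucc n b := by
    rw [map_mul, ← conj_pureHom_braidSucc]
    group
  induction g using braid_induction with
  | h1 => exact ⟨1, 1, n, le_rfl, by simp [cosetRep_self]⟩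
  | hmul g i hi ih =>
    obtain ⟨f, b, k, hk, rfl⟩ := ih
    have hi : i < n := hi
    rcases lt_trichotomy i k with h | h | h
    · rcases Nat.lt_or_ge (i + 1) k with h' | h'
      · refine ⟨f, b * braidGen n i, k, hk, ?_⟩
        rw [map_mul, braidSucc_braidGen (by omega), mul_assoc,
          ← (hs.commute_cosetRep h' hk).eq]
        group
      · obtain rfl : k = i + 1 := by omega
        refine ⟨f, b, i, by omega, ?_⟩
        rw [cosetRep_of_lt _ hi]
        group
    · subst h
      refine ⟨f * braidAction n b (FreeGroup.of i), b, i + 1, hi, ?_⟩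
      rw [← hmove, pureHom_of, pureGen_of_lt _ hi, cosetRep_of_lt _ hi]
      group
    · obtain ⟨j, rfl⟩ : ∃ j, i = j + 1 := ⟨i - 1, by omega⟩
      refine ⟨f, b * braidGen n j, k, hk, ?_⟩
      rw [map_mul, braidSucc_braidGen (by omega), mul_assoc,
        hs.cosetRep_mul (by omega) hi]
      group
  | hinv g i hi ih =>
    obtain ⟨f, b, k, hk, rfl⟩ := ih
    have hi : i < n := hi
    rcases lt_trichotomy i k with h | h | h
    · rcases Nat.lt_or_ge (i + 1) k with h' | h'
      · refine ⟨f, b * (braidGen n i)⁻¹, k, hk, ?_⟩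
        rw [map_mul, map_inv, braidSucc_braidGen (by omega), mul_assoc,
          ← (hs.commute_cosetRep h' hk).inv_left.eq]
        group
      · obtain rfl : k = i + 1 := by omega
        refine ⟨f * braidAction n b (FreeGroup.of i)⁻¹, b, i, by omega, ?_⟩
        rw [← hmove, map_inv, pureHom_of, pureGen_of_lt _ hi, cosetRep_of_lt _ hi]
        group
    · subst h
      refine ⟨f, b, i + 1, hi, ?_⟩
      rw [cosetRep_of_lt _ hi]
      group
    · obtain ⟨j, rfl⟩ : ∃ j, i = j + 1 := ⟨i - 1, by omega⟩
      refine ⟨f, b * (braidGen n j)⁻¹, k, hk, ?_⟩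
      have := hs.cosetRep_mul (i := j) (k := k) (by omega) hi
      rw [map_mul, map_inv, braidSucc_braidGen (by omega), mul_inv_eq_iff_eq_mul]
      simp only [mul_assoc]
      rw [this, inv_mul_cancel_left]

/-- The endomorphism of the free group killing the generators `x_k` with `n ≤ k`. -/
def truncHom (n : ℕ) : FreeGroup ℕ →* FreeGroup ℕ :=
  FreeGroup.lift fun k => if k < n then FreeGroup.of k else 1

lemma truncHom_of_lt {n k : ℕ} (h : k < n) : truncHom n (FreeGroup.of k) = FreeGroup.of k := by
  simp [truncHom, h]

lemma truncHom_of_le {n k : ℕ} (h : n ≤ k) : truncHom n (FreeGroup.of k) = 1 := by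
  simp [truncHom, h]

lemma pureHom_truncHom {G : Type*} [Group G] (s : ℕ → G) (n : ℕ) (f : FreeGroup ℕ) :
    pureHom s n (truncHom n f) = pureHom s n f := by
  suffices h : (pureHom s n).comp (truncHom n) = pureHom s n from DFunLike.congr_fun h f
  ext k
  rcases Nat.lt_or_ge k n with h | h
  · simp [truncHom_of_lt h]
  · simp [truncHom_of_le h, pureGen_of_le s h]

lemma truncHom_sigma {n i : ℕ} (hi : i + 1 < n) (f : FreeGroup ℕ) :
    truncHom n (sigma i f) = sigma i (truncHom n f) := by
  suffices h : (truncHom n).comp (sigma i).toMonoidHom =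
      (sigma i).toMonoidHom.comp (truncHom n) from DFunLike.congr_fun h f
  ext k
  by_cases h1 : k = i
  · subst h1
    simp [sigma_left, truncHom_of_lt hi, truncHom_of_lt (by omega : k < n)]
  by_cases h2 : k = i + 1
  · subst h2
    simp [sigma_right, truncHom_of_lt hi, truncHom_of_lt (by omega : i < n)]
  rcases Nat.lt_or_ge k n with h | h
  · simp [sigma_of_ne h1 h2, truncHom_of_lt h]
  · simp [sigma_of_ne h1 h2, truncHom_of_le h]

lemma truncHom_braidAction (n : ℕ) (g : PresentedGroup (braidRels n)) (f : FreeGroup ℕ) :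
    truncHom n (braidAction n g f) = braidAction n g (truncHom n f) := by
  induction g using braid_induction generalizing f with
  | h1 => simp
  | hmul g i hi ih =>
    rw [map_mul, MulAut.mul_apply, MulAut.mul_apply, ih, braidAction_braidGen hi,
      truncHom_sigma (by omega)]
  | hinv g i hi ih =>
    rw [map_mul, MulAut.mul_apply, MulAut.mul_apply, ih, map_inv, braidAction_braidGen hi]
    congr 1
    apply (sigma i).injective
    rw [← truncHom_sigma (by omega), MulAut.apply_inv_self, MulAut.apply_inv_self]

lemma braidAction_of_le {n k : ℕ} (h : n ≤ k) (g : PresentedGroup (braidRels n)) :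
    braidAction n g (FreeGroup.of k) = FreeGroup.of k := by
  induction g using braid_induction with
  | h1 => simp
  | hmul g i hi ih =>
    rw [map_mul, MulAut.mul_apply, braidAction_braidGen hi, sigma_of_ne (by omega) (by omega), ih]
  | hinv g i hi ih =>
    rw [map_mul, MulAut.mul_apply, map_inv, braidAction_braidGen hi]
    nth_rw 1 [← sigma_of_ne (i := i) (j := k) (by omega) (by omega)]
    rw [MulAut.inv_apply_self, ih]

/-- `g` acts trivially modulo `x_n, x_{n+1}, …` and conjugates `x_n` by a word which is `f` modulo
`x_n, x_{n+1}, …`. -/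
def Pushes (n : ℕ) (g : MulAut (FreeGroup ℕ)) (f : FreeGroup ℕ) : Prop :=
  (∃ w, g (FreeGroup.of n) = w⁻¹ * FreeGroup.of n * w ∧ truncHom n w = truncHom n f) ∧
    ∀ y, truncHom n (g y) = truncHom n y

lemma Pushes.one (n : ℕ) : Pushes n 1 1 := ⟨⟨1, by simp, rfl⟩, fun _ => rfl⟩

lemma Pushes.mul {n : ℕ} {g g' : MulAut (FreeGroup ℕ)} {f f' : FreeGroup ℕ} (h : Pushes n g f)
    (h' : Pushes n g' f') : Pushes n (g * g') (f * f') := by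
  obtain ⟨⟨w, hw, hwf⟩, ht⟩ := h
  obtain ⟨⟨w', hw', hwf'⟩, ht'⟩ := h'
  refine ⟨⟨w * g w', ?_, ?_⟩, fun y => ?_⟩
  · rw [MulAut.mul_apply, hw', map_mul, map_mul, map_inv, hw]
    group
  · rw [map_mul, map_mul, ht, hwf, hwf']
  · rw [MulAut.mul_apply, ht, ht']

lemma Pushes.inv {n : ℕ} {g : MulAut (FreeGroup ℕ)} {f : FreeGroup ℕ} (h : Pushes n g f) :
    Pushes n g⁻¹ f⁻¹ := by
  obtain ⟨⟨w, hw, hwf⟩, ht⟩ := h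
  have ht' (y : FreeGroup ℕ) : truncHom n (g⁻¹ y) = truncHom n y := by
    rw [← ht, MulAut.apply_inv_self]
  refine ⟨⟨(g⁻¹ w)⁻¹, ?_, ?_⟩, ht'⟩
  · apply g.injective
    simp only [map_mul, map_inv, MulAut.apply_inv_self, hw]
    group
  · rw [map_inv, map_inv, ht', hwf]

lemma Pushes.of_conj_sigma {n i : ℕ} (hi : i + 1 < n) {g : MulAut (FreeGroup ℕ)}
    {f : FreeGroup ℕ} (h : Pushes n (sigma i * g * (sigma i)⁻¹) (sigma i f)) : Pushes n g f := by
  obtain ⟨⟨w, hw, hwf⟩, ht⟩ := h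
  have hn : sigma i (FreeGroup.of n) = FreeGroup.of n := sigma_of_ne (by omega) (by omega)
  have hn' : (sigma i)⁻¹ (FreeGroup.of n) = FreeGroup.of n := by
    apply (sigma i).injective
    rw [MulAut.apply_inv_self, hn]
  refine ⟨⟨(sigma i)⁻¹ w, ?_, ?_⟩, fun y => ?_⟩
  · apply (sigma i).injective
    rw [MulAut.mul_apply, MulAut.mul_apply, hn'] at hw
    simp only [map_mul, map_inv, MulAut.apply_inv_self, hw, hn]
  · apply (sigma i).injective
    rw [← truncHom_sigma hi, ← truncHom_sigma hi, MulAut.apply_inv_self, hwf]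
  · apply (sigma i).injective
    have := ht (sigma i y)
    rw [MulAut.mul_apply, MulAut.mul_apply, MulAut.inv_apply_self] at this
    rw [← truncHom_sigma hi, this, truncHom_sigma hi]

lemma pushes_sigma_sq (i : ℕ) : Pushes (i + 1) (sigma i * sigma i) (FreeGroup.of i) := by
  refine ⟨⟨FreeGroup.of i * FreeGroup.of (i + 1), ?_, ?_⟩, fun y => ?_⟩
  · simp only [MulAut.mul_apply, sigma_right, sigma_left, map_mul, map_inv]
    group
  · simp [truncHom_of_le]
  · suffices h : (truncHom (i + 1)).comp (sigma i * sigma i).toMonoidHom = truncHom (i + 1) from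
      DFunLike.congr_fun h y
    ext k
    by_cases h1 : k = i
    · subst h1
      simp [sigma_left, sigma_right, truncHom_of_le]
    by_cases h2 : k = i + 1
    · subst h2
      simp [sigma_left, sigma_right, truncHom_of_le]
    simp [sigma_of_ne h1 h2]

lemma pushes_pureGen (n k : ℕ) :
    Pushes n (braidAction (n + 1) (pureGen (braidGen (n + 1)) n k)) (FreeGroup.of k) := by
  have hs : ArtinRelations (braidGen (n + 1)) n := artinRelations_braidGen (n + 1)
  rcases Nat.lt_or_ge k n with hk | hk
  · obtain ⟨m, rfl⟩ : ∃ m, n = m + 1 := ⟨n - 1, by omega⟩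
    have hkm : k ≤ m := by omega
    induction hkm using Nat.decreasingInduction with
    | self =>
      rw [pureGen_of_lt _ hk, cosetRep_self, one_mul, inv_one, mul_one, map_mul,
        braidAction_braidGen (by omega)]
      exact pushes_sigma_sq m
    | of_succ k hkm ih =>
      have hk1 : k + 1 < m + 1 := by omega
      apply Pushes.of_conj_sigma hk1
      have h := ih hk1
      rwa [← hs.conj_pureGen hk1, map_mul, map_mul, map_inv, braidAction_braidGen (by omega),
        ← sigma_left] at h
  · rw [pureGen_of_le _ hk, map_one]
    exact ⟨⟨1, by simp, by rw [map_one, truncHom_of_le hk]⟩, fun _ => rfl⟩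

lemma pushes_pureHom (n : ℕ) (f : FreeGroup ℕ) :
    Pushes n (braidAction (n + 1) (pureHom (braidGen (n + 1)) n f)) f := by
  induction f using FreeGroup.induction_on with
  | C1 => simpa using Pushes.one n
  | of k => simpa using pushes_pureGen n k
  | inv_of k h => simpa using h.inv
  | mul _ _ hf hg => simpa using hf.mul hg

/-- An element commuting with `x_n` becomes trivial when `x_n, x_{n+1}, …` are killed. -/
lemma truncHom_eq_one_of_commute {n : ℕ} {w : FreeGroup ℕ} (h : Commute w (FreeGroup.of n)) :
    truncHom n w = 1 := by
  let τ : Equiv.Perm (FreeGroup ℕ × Bool) := Equiv.swap (1, false) (1, true)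
  have hτ (y) : (τ y).1 = y.1 := by
    simp only [τ, Equiv.swap_apply_def]
    split_ifs with h1 h2
    · rw [h1]
    · rw [h2]
    · rfl
  let ρ : FreeGroup ℕ →* Equiv.Perm (FreeGroup ℕ × Bool) := FreeGroup.lift fun k =>
    if k < n then (Equiv.mulLeft (FreeGroup.of k)).prodCongr (Equiv.refl Bool)
    else if k = n then τ else 1
  have hρn : ρ (FreeGroup.of n) = τ := by simp [ρ]
  have hρ (v : FreeGroup ℕ) : ∀ y, (ρ v y).1 = truncHom n v * y.1 := by
    induction v using FreeGroup.induction_on with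
    | C1 => simp
    | of k =>
      intro y
      rcases lt_trichotomy k n with hk | hk | hk
      · simp [ρ, hk, truncHom]
      · subst hk
        rw [hρn, hτ, truncHom_of_le le_rfl, one_mul]
      · simp [ρ, truncHom, not_lt.2 hk.le, hk.ne']
    | inv_of k hk =>
      intro y
      have := hk ((ρ (FreeGroup.of k))⁻¹ y)
      rw [← Equiv.Perm.mul_apply, mul_inv_cancel, Equiv.Perm.one_apply] at this
      rw [map_inv, map_inv, this, inv_mul_cancel_left]
    | mul v v' hv hv' =>
      intro y
      rw [map_mul, map_mul, Equiv.Perm.mul_apply, hv, hv', mul_assoc]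
  by_contra hw
  have h1 : ρ w * τ = τ * ρ w := by
    rw [← hρn, ← map_mul, ← map_mul, h.eq]
  have h2 := Equiv.congr_fun h1 (1, false)
  have h3 : (ρ w (1, false)).1 ≠ 1 := by rw [hρ]; simpa using hw
  have h4 : τ (ρ w (1, false)) = ρ w (1, false) :=
    Equiv.swap_apply_of_ne_of_ne (fun e => h3 (by rw [e])) (fun e => h3 (by rw [e]))
  rw [Equiv.Perm.mul_apply, Equiv.Perm.mul_apply, h4] at h2
  have h5 := (ρ w).injective h2
  simp [τ] at h5

lemma braidAction_cosetRep {n k : ℕ} (hk : k ≤ n) :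
    braidAction (n + 1) (cosetRep (braidGen (n + 1)) n k) (FreeGroup.of k) = FreeGroup.of n := by
  induction hk using Nat.decreasingInduction with
  | self => simp [cosetRep_self]
  | of_succ k hk ih =>
    rw [cosetRep_of_lt _ hk, map_mul, MulAut.mul_apply, braidAction_braidGen (by omega),
      sigma_left, ih]

lemma braidAction_injective (n : ℕ) : Function.Injective (braidAction n) := by
  rw [injective_iff_map_eq_one]
  induction n with
  | zero =>
    intro g _
    induction g using braid_induction with
    | h1 => rfl
    | hmul g i hi => omega
    | hinv g i hi => omega
  | succ n ih =>
    intro g hg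
    obtain ⟨f, b, k, hk, rfl⟩ := exists_eq_pureHom_mul_braidSucc_mul n g
    obtain ⟨⟨w, hw, hwf⟩, ht⟩ := pushes_pureHom n f
    rw [map_mul, map_mul, braidAction_braidSucc] at hg
    obtain rfl : k = n := by
      by_contra hkn
      have h := DFunLike.congr_fun hg (FreeGroup.of k)
      rw [MulAut.mul_apply, braidAction_cosetRep hk, MulAut.mul_apply, braidAction_of_le le_rfl,
        hw] at h
      have h' := congrArg (truncHom n) h
      simp [truncHom_of_le, truncHom_of_lt (lt_of_le_of_ne hk hkn)] at h'
    rw [cosetRep_self, map_one, mul_one] at hg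
    have hb : b = 1 := by
      apply ih
      apply FreeGroup.mulAut_ext
      intro j
      rcases Nat.lt_or_ge j k with hj | hj
      · have h := congrArg (truncHom k) (DFunLike.congr_fun hg (FreeGroup.of j))
        rw [MulAut.mul_apply, ht, truncHom_braidAction, MulAut.one_apply,
          truncHom_of_lt hj] at h
        exact h
      · exact braidAction_of_le hj b
    subst hb
    rw [map_one, mul_one] at hg
    have hcomm : Commute w (FreeGroup.of k) := by
      rw [hg, MulAut.one_apply, mul_assoc, eq_inv_mul_iff_mul_eq] at hw
      exact hw
    rw [cosetRep_self, map_one, mul_one, mul_one, ← pureHom_truncHom, ← hwf,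
      truncHom_eq_one_of_commute hcomm, map_one]

end Faithfulness

section FiniteRank

/-- The automorphism `σᵢ` of the free group on `n` generators. -/
def finSigma {n : ℕ} (i : Fin (n - 1)) : MulAut (FreeGroup (Fin n)) :=
  artinAut (a := ⟨(i : ℕ), by omega⟩) (b := ⟨(i : ℕ) + 1, by omega⟩) (by simp)

/-- The Artin representation of the braid group in the automorphism group of the free group. -/
def artinRepresentation (n : ℕ) :
    PresentedGroup (braidRels n) →* MulAut (FreeGroup (Fin n)) :=
  PresentedGroup.toGroup (rels := braidRels n) (f := finSigma)
    (braidRels_lift_eq_one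
      (fun i j hij => artinAut_commute _ _ (by simp; omega) (by simp; omega) (by simp; omega)
        (by simp; omega))
      (fun i j hij => by
        unfold finSigma
        simp only [hij]
        exact artinAut_braid _ _ (by simp; omega)))

lemma artinRepresentation_of {n : ℕ} (i : Fin (n - 1)) :
    artinRepresentation n (PresentedGroup.of i) = finSigma i :=
  PresentedGroup.toGroup.of (rels := braidRels n) _

lemma map_val_finSigma {n : ℕ} (i : Fin (n - 1)) (f : FreeGroup (Fin n)) :
    FreeGroup.map Fin.val (finSigma i f) = sigma i (FreeGroup.map Fin.val f) := by
  suffices h : (FreeGroup.map Fin.val).comp (finSigma i).toMonoidHom =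
      (sigma i).toMonoidHom.comp (FreeGroup.map Fin.val) from DFunLike.congr_fun h f
  ext k
  by_cases h1 : (k : ℕ) = i
  · rw [show k = ⟨(i : ℕ), by omega⟩ from Fin.ext h1]
    simp [finSigma, sigma_left]
  by_cases h2 : (k : ℕ) = i + 1
  · rw [show k = ⟨(i : ℕ) + 1, by omega⟩ from Fin.ext h2]
    simp [finSigma, sigma_right]
  · have h : finSigma i (FreeGroup.of k) = FreeGroup.of k :=
      artinAut_of_ne _ (fun e => h1 (congrArg Fin.val e)) (fun e => h2 (congrArg Fin.val e))
    simp [h, sigma_of_ne h1 h2]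

lemma map_val_artinRepresentation {n : ℕ} (g : PresentedGroup (braidRels n))
    (f : FreeGroup (Fin n)) :
    FreeGroup.map Fin.val (artinRepresentation n g f) =
      braidAction n g (FreeGroup.map Fin.val f) := by
  induction g using braid_induction generalizing f with
  | h1 => simp
  | hmul g i hi ih =>
    rw [map_mul, map_mul, MulAut.mul_apply, MulAut.mul_apply, ih, braidAction_braidGen hi,
      braidGen_of_lt hi, artinRepresentation_of, map_val_finSigma]
  | hinv g i hi ih =>
    rw [map_mul, map_mul, MulAut.mul_apply, MulAut.mul_apply, ih, map_inv, map_inv,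
      braidAction_braidGen hi, braidGen_of_lt hi, artinRepresentation_of]
    congr 1
    apply (sigma i).injective
    rw [MulAut.apply_inv_self, ← map_val_finSigma ⟨i, hi⟩, MulAut.apply_inv_self]

lemma artinRepresentation_injective (n : ℕ) : Function.Injective (artinRepresentation n) := by
  rw [injective_iff_map_eq_one]
  intro g hg
  apply braidAction_injective n
  rw [map_one]
  apply FreeGroup.mulAut_ext
  intro j
  rcases Nat.lt_or_ge j n with hj | hj
  · have h := map_val_artinRepresentation g (FreeGroup.of ⟨j, hj⟩)
    simpa [hg] using h.symm
  · exact braidAction_of_le hj g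

end FiniteRank

/-- The braid group is, by definition, the group given by the Artin presentation. -/
def braidGroupEquiv (n : ℕ) : BraidGroup n ≃* PresentedGroup (braidRels n) where
  toFun g := g
  invFun g := g
  left_inv _ := rfl
  right_inv _ := rfl
  map_mul' _ _ := rfl

/-- (Artin) For `n > 2`, the automorphisms `σᵢ` of the free group `Fₙ` on `x₁,…,xₙ` given
by `σᵢ(xᵢ) = x_{i+1}`, `σᵢ(x_{i+1}) = x_{i+1}⁻¹ xᵢ x_{i+1}` and `σᵢ(x_j) = x_j` for
`j ≠ i, i+1` satisfy the Artin relations, hence induce a homomorphism from the braid group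
`Bₙ` (with its Artin presentation) into `Aut(Fₙ)`, and this homomorphism is injective. -/
theorem braidGroup_embeds_in_autFreeGroup (n : ℕ) (hn : 2 < n) :
    ∃ Φ : BraidGroup n →* MulAut (FreeGroup (Fin n)),
      (∀ i : Fin (n - 1),
        (Φ (PresentedGroup.of (rels := braidRels n) i))
            (FreeGroup.of ⟨(i : ℕ), by have := i.isLt; omega⟩) =
          FreeGroup.of ⟨(i : ℕ) + 1, by have := i.isLt; omega⟩ ∧
        (Φ (PresentedGroup.of (rels := braidRels n) i))
            (FreeGroup.of ⟨(i : ℕ) + 1, by have := i.isLt; omega⟩) =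
          (FreeGroup.of ⟨(i : ℕ) + 1, by have := i.isLt; omega⟩)⁻¹ *
            FreeGroup.of ⟨(i : ℕ), by have := i.isLt; omega⟩ *
            FreeGroup.of ⟨(i : ℕ) + 1, by have := i.isLt; omega⟩ ∧
        ∀ j : Fin n, (j : ℕ) ≠ (i : ℕ) → (j : ℕ) ≠ (i : ℕ) + 1 →
          (Φ (PresentedGroup.of (rels := braidRels n) i)) (FreeGroup.of j) =
            FreeGroup.of j) ∧
      Function.Injective Φ := by
  refine ⟨(artinRepresentation n).comp (braidGroupEquiv n).toMonoidHom, fun i => ?_,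
    (artinRepresentation_injective n).comp (braidGroupEquiv n).injective⟩
  have h : (artinRepresentation n).comp (braidGroupEquiv n).toMonoidHom
      (PresentedGroup.of (rels := braidRels n) i) = finSigma i := artinRepresentation_of i
  rw [h]
  refine ⟨artinAut_of_left _, artinAut_of_right _, fun j h1 h2 => ?_⟩
  exact artinAut_of_ne _ (fun e => h1 (congrArg Fin.val e)) (fun e => h2 (congrArg Fin.val e))
end

section
/- Let F be a finitely generated free group and let U be a nontrivial element of F that is not a power of any primitive element of F (a primitive element is one belonging to some free basis of F). Then the one-relator quotient F/N(U), where N(U) is the normal closure of U in F, is a nontrivial infinite group. -/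
universe u

/-- An element of a group is primitive if it belongs to some free basis. -/
def IsPrimitiveElement {F : Type u} [Group F] (p : F) : Prop :=
  ∃ (ι : Type u) (b : FreeGroupBasis ι F) (i : ι), b i = p

namespace FreeGroupBasis

/-- A free basis generates the group. -/
theorem closure_range_eq_top {ι : Type*} {G : Type*} [Group G] (b : FreeGroupBasis ι G) :
    Subgroup.closure (Set.range b) = ⊤ := by
  have h : Set.range b = (b.repr.symm : FreeGroup ι →* G) '' Set.range FreeGroup.of := by
    rw [← Set.range_comp]
    rfl
  rw [h, ← MonoidHom.map_closure, FreeGroup.closure_range_of, ← MonoidHom.range_eq_map]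
  exact MonoidHom.range_eq_top.2 b.repr.symm.surjective

/-- If a free basis has two distinct elements, every element of the group lies in the kernel of
some nontrivial homomorphism to the integers. -/
theorem exists_hom_int_apply_eq_one {ι : Type*} {G : Type*} [Group G] (b : FreeGroupBasis ι G)
    {x y : ι} (hxy : x ≠ y) (u : G) :
    ∃ φ : G →* Multiplicative ℤ, φ u = 1 ∧ ∃ g, φ g ≠ 1 := by
  classical
  let e (i : ι) : G →* Multiplicative ℤ := b.lift (Pi.mulSingle i (Multiplicative.ofAdd 1))
  have he (i : ι) : e i (b i) = Multiplicative.ofAdd 1 := by simp [e]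
  have hne {i j : ι} (h : j ≠ i) : e i (b j) = 1 := by simp [e, h]
  have h1 : Multiplicative.ofAdd (1 : ℤ) ≠ 1 := by simp
  by_cases hx : e x u = 1
  · exact ⟨e x, hx, b x, by rw [he]; exact h1⟩
  · refine ⟨e x ^ (e y u).toAdd * e y ^ (-(e x u).toAdd), ?_, b y, ?_⟩
    · apply Multiplicative.toAdd.injective
      simp [mul_comm]
    · simpa [he, hne hxy.symm, ← ofAdd_zsmul] using hx

end FreeGroupBasis

/-- A quotient by the normal closure of `u` is infinite if `u` is killed by a nontrivial
homomorphism to the integers. -/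
theorem infinite_quotient_normalClosure_of_hom_int {G : Type*} [Group G] {u g : G}
    (φ : G →* Multiplicative ℤ) (hu : φ u = 1) (hg : φ g ≠ 1) :
    Infinite (G ⧸ Subgroup.normalClosure {u}) := by
  by_contra h
  rw [not_infinite_iff_finite] at h
  have hle : Subgroup.normalClosure {u} ≤ φ.ker :=
    Subgroup.normalClosure_le_normal (by simpa using hu)
  have hfin : IsOfFinOrder (φ g) := (QuotientGroup.lift _ φ hle).isOfFinOrder
    (isOfFinOrder_of_finite (g : G ⧸ Subgroup.normalClosure {u}))
  exact hg ((isOfFinOrder_iff_eq_one _).1 hfin)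

/-- Let `F` be a finitely generated free group and `U` a nontrivial element of `F` that is
not a power of any primitive element of `F`. Then the one-relator quotient `F/N(U)`, where
`N(U)` is the normal closure of `U` in `F`, is a nontrivial infinite group. -/
theorem oneRelatorQuotient_infinite {F : Type u} [Group F] [IsFreeGroup F] [Group.FG F]
    (U : F) (hU : U ≠ 1)
    (hprim : ¬ ∃ (p : F) (k : ℤ), IsPrimitiveElement p ∧ U = p ^ k) :
    Nontrivial (F ⧸ Subgroup.normalClosure {U}) ∧
      Infinite (F ⧸ Subgroup.normalClosure {U}) := by
  have hinf : Infinite (F ⧸ Subgroup.normalClosure {U}) := by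
    let b := IsFreeGroup.basis F
    have hmem : U ∈ Subgroup.closure (Set.range b) := by
      rw [b.closure_range_eq_top]
      trivial
    rcases subsingleton_or_nontrivial (IsFreeGroup.Generators F) with hs | hn
    · rcases isEmpty_or_nonempty (IsFreeGroup.Generators F) with he | ⟨⟨x⟩⟩
      · rw [Set.range_eq_empty, Subgroup.closure_empty] at hmem
        exact absurd (Subgroup.mem_bot.1 hmem) hU
      · have : Set.range b = {b x} := by
          let _ : Unique (IsFreeGroup.Generators F) := uniqueOfSubsingleton x
          rw [Set.range_unique, Subsingleton.elim default x]
        rw [this, Subgroup.mem_closure_singleton] at hmem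
        obtain ⟨k, hk⟩ := hmem
        exact absurd ⟨b x, k, ⟨_, b, x, rfl⟩, hk.symm⟩ hprim
    · obtain ⟨x, y, hxy⟩ := hn
      obtain ⟨φ, hφ, g, hg⟩ := b.exists_hom_int_apply_eq_one hxy U
      exact infinite_quotient_normalClosure_of_hom_int φ hφ hg
  exact ⟨inferInstance, hinf⟩
end

section
/- Every polycyclic group can be embedded in GL(n,ℤ) for some n; that is, if G is a group admitting a finite subnormal series 1 = G₁ ⊴ G₂ ⊴ ⋯ ⊴ G_{k+1} = G in which each Gᵢ is normal in G_{i+1} and each quotient G_{i+1}/Gᵢ is cyclic, then there exist n ∈ ℕ and an injective group homomorphism G → GL(n,ℤ). -/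
/-- `PolyZ n Γ`: the group `Γ` has a subnormal series of length `n` whose factors embed in `ℤ`. -/
def PolyZ : ℕ → (Γ : Type*) → [Group Γ] → Prop
  | 0, Γ, _ => Subsingleton Γ
  | n + 1, Γ, _ => ∃ φ : Γ →* Multiplicative ℤ, PolyZ n φ.ker

theorem PolyZ.of_injective {n : ℕ} {Γ Δ : Type*} [Group Γ] [Group Δ] (h : PolyZ n Γ) (f : Δ →* Γ)
    (hf : Function.Injective f) : PolyZ n Δ := by
  induction n generalizing Γ Δ with
  | zero => exact @Function.Injective.subsingleton _ _ f hf h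
  | succ n ih =>
    obtain ⟨φ, hφ⟩ := h
    refine ⟨φ.comp f, ih hφ ((f.comp (φ.comp f).ker.subtype).codRestrict φ.ker
      fun x => x.2) ?_⟩
    intro x y hxy
    exact Subtype.ext (hf (congrArg Subtype.val hxy))

theorem MonoidHom.exists_zpow_mul_mem_ker {Γ C : Type*} [Group Γ] [Group C] [IsCyclic C]
    (φ : Γ →* C) : ∃ x : Γ, ∀ g, ∃ j : ℤ, x ^ j * g ∈ φ.ker := by
  obtain ⟨⟨_, x, rfl⟩, hx⟩ := IsCyclic.exists_generator (α := φ.range)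
  refine ⟨x, fun g => ?_⟩
  obtain ⟨j, hj⟩ := hx ⟨φ g, g, rfl⟩
  refine ⟨-j, ?_⟩
  have : φ x ^ j = φ g := congrArg Subtype.val hj
  simp [MonoidHom.mem_ker, this]

theorem Group.FG.of_zpow_mul_mem {Γ : Type*} [Group Γ] (N : Subgroup Γ) [Group.FG N] (x : Γ)
    (hx : ∀ g, ∃ j : ℤ, x ^ j * g ∈ N) : Group.FG Γ := by
  have hN : N.FG := (Group.fg_iff_subgroup_fg N).1 inferInstance
  obtain ⟨S, hS⟩ := hN
  classical
  refine ⟨⟨insert x S, ?_⟩⟩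
  rw [eq_top_iff]
  intro g _
  obtain ⟨j, hj⟩ := hx g
  have h1 : N ≤ Subgroup.closure (↑(insert x S) : Set Γ) := by
    rw [← hS]; exact Subgroup.closure_mono (by simp)
  have h2 : x ∈ Subgroup.closure (↑(insert x S) : Set Γ) := Subgroup.subset_closure (by simp)
  simpa using Subgroup.mul_mem _ (Subgroup.zpow_mem _ h2 (-j)) (h1 hj)

theorem PolyZ.fg {n : ℕ} {Γ : Type*} [Group Γ] (h : PolyZ n Γ) : Group.FG Γ := by
  induction n generalizing Γ with
  | zero =>
    have : Subsingleton Γ := h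
    exact Group.fg_of_finite
  | succ n ih =>
    obtain ⟨φ, hφ⟩ := h
    obtain ⟨x, hx⟩ := φ.exists_zpow_mul_mem_ker
    have := ih hφ
    exact Group.FG.of_zpow_mul_mem φ.ker x hx

theorem Subgroup.index_ne_zero_of_zpow_mul_mem {Γ : Type*} [Group Γ] (N Q : Subgroup Γ) [N.Normal]
    (x : Γ) (hx : ∀ g, ∃ j : ℤ, x ^ j * g ∈ N) (hQ : Q.relIndex N ≠ 0) {k : ℕ} (hk : 0 < k)
    (hxk : x ^ k ∈ Q) : Q.index ≠ 0 := by
  have : (Q.subgroupOf N).FiniteIndex := ⟨hQ⟩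
  let f : Fin k × (N ⧸ Q.subgroupOf N) → Γ ⧸ Q := fun p => (x ^ (p.1 : ℕ) * (p.2.out : Γ) : Γ)
  have hf : Function.Surjective f := by
    intro q
    obtain ⟨g, rfl⟩ := QuotientGroup.mk_surjective q
    obtain ⟨j, hj⟩ := hx g
    have hk' : (k : ℤ) ≠ 0 := by positivity
    set r := (-j) % k with hr
    set t := (-j) / k with ht
    have hr0 : 0 ≤ r := Int.emod_nonneg _ hk'
    have hrk : r < k := Int.emod_lt_of_pos _ (by positivity)
    have hrt : r + k * t = -j := Int.emod_add_mul_ediv _ _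
    let n : N := ⟨x ^ (k * t) * (x ^ j * g) * (x ^ (k * t))⁻¹, Subgroup.Normal.conj_mem ‹_› _ hj _⟩
    refine ⟨(⟨r.toNat, by omega⟩, (n : N ⧸ Q.subgroupOf N)), ?_⟩
    rw [QuotientGroup.eq]
    have h1 : ((n : N ⧸ Q.subgroupOf N).out : N)⁻¹ * n ∈ Q.subgroupOf N := by
      rw [← QuotientGroup.eq]; simp
    have h2 := Subgroup.mem_subgroupOf.1 h1
    have h3 : x ^ ((k : ℤ) * t) ∈ Q := by
      rw [zpow_mul]; exact Q.zpow_mem (by simpa using hxk) _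
    have h4 : x ^ (r.toNat) = x ^ (-j - k * t) := by
      rw [← zpow_natCast, Int.toNat_of_nonneg hr0]; congr 1; omega
    have h5 := Q.mul_mem h2 h3
    convert h5 using 1
    simp only [n, h4, Subgroup.coe_mul, Subgroup.coe_inv, zpow_sub, zpow_neg]
    group
  have := Finite.of_surjective f hf
  exact Subgroup.index_ne_zero_of_finite

theorem Subgroup.index_ne_zero_mono {Γ : Type*} [Group Γ] {H K : Subgroup Γ} (hHK : H ≤ K)
    (h : H.index ≠ 0) : K.index ≠ 0 := fun h' =>
  h (Nat.eq_zero_of_zero_dvd (h' ▸ Subgroup.index_dvd_of_le hHK))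

/-- The subgroup generated by the `m`-th powers of the elements of `N`. -/
def Subgroup.powers {Γ : Type*} [Group Γ] (N : Subgroup Γ) (m : ℕ) : Subgroup Γ :=
  Subgroup.closure ((fun g => g ^ m) '' (N : Set Γ))

theorem Subgroup.powers_le {Γ : Type*} [Group Γ] (N : Subgroup Γ) (m : ℕ) : N.powers m ≤ N := by
  rw [Subgroup.powers, Subgroup.closure_le]
  rintro _ ⟨g, hg, rfl⟩
  exact N.pow_mem hg m

instance Subgroup.powers_normal {Γ : Type*} [Group Γ] (N : Subgroup Γ) [hN : N.Normal] (m : ℕ) :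
    (N.powers m).Normal := by
  have : (N.powers m) = Subgroup.normalClosure ((fun g => g ^ m) '' (N : Set Γ)) := by
    refine le_antisymm Subgroup.closure_le_normalClosure ?_
    rw [Subgroup.normalClosure, Subgroup.powers]
    refine Subgroup.closure_mono ?_
    intro g hg
    obtain ⟨_, ⟨a, ha, rfl⟩, hc⟩ := Group.mem_conjugatesOfSet_iff.1 hg
    obtain ⟨c, rfl⟩ := isConj_iff.1 hc
    exact ⟨c * a * c⁻¹, hN.conj_mem a ha c, by simp⟩
  rw [this]
  infer_instance

theorem PolyZ.index_powers_ne_zero {n : ℕ} {Γ : Type*} [Group Γ] (h : PolyZ n Γ) {m : ℕ}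
    (hm : 0 < m) : ((⊤ : Subgroup Γ).powers m).index ≠ 0 := by
  induction n generalizing Γ with
  | zero =>
    have : Subsingleton Γ := h
    exact Subgroup.index_ne_zero_of_finite
  | succ n ih =>
    obtain ⟨φ, hφ⟩ := h
    obtain ⟨x, hx⟩ := φ.exists_zpow_mul_mem_ker
    refine Subgroup.index_ne_zero_of_zpow_mul_mem φ.ker _ x hx ?_ hm
      (Subgroup.subset_closure ⟨x, trivial, rfl⟩)
    refine Subgroup.index_ne_zero_mono ?_ (ih hφ)
    conv_lhs => rw [Subgroup.powers]
    rw [Subgroup.closure_le]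
    rintro _ ⟨g, -, rfl⟩
    exact Subgroup.mem_subgroupOf.2 (Subgroup.subset_closure ⟨g, trivial, rfl⟩)

/-- `Γ` has a finite index subgroup with a finite series whose factors embed in `ℤ`. -/
def VirtuallyPolyZ (Γ : Type*) [Group Γ] : Prop :=
  ∃ (n : ℕ) (H : Subgroup Γ), H.index ≠ 0 ∧ PolyZ n H

theorem VirtuallyPolyZ.of_mulEquiv {Γ Δ : Type*} [Group Γ] [Group Δ] (h : VirtuallyPolyZ Γ)
    (e : Γ ≃* Δ) : VirtuallyPolyZ Δ := by
  obtain ⟨n, H, hi, hp⟩ := h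
  refine ⟨n, H.comap e.symm.toMonoidHom, ?_, hp.of_injective
    ((e.symm.toMonoidHom.comp (Subgroup.subtype _)).codRestrict H fun x => x.2) ?_⟩
  · rwa [Subgroup.index_comap_of_surjective _ e.symm.surjective]
  · intro x y hxy
    exact Subtype.ext (e.symm.injective (congrArg Subtype.val hxy))

theorem Subgroup.relIndex_powers_ne_zero {Γ : Type*} [Group Γ] (N : Subgroup Γ) {n : ℕ}
    {H : Subgroup N} (hH : H.index ≠ 0) (hp : PolyZ n H) {m : ℕ} (hm : 0 < m) :
    (N.powers m).relIndex N ≠ 0 := by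
  have h1 : ((H.map N.subtype).powers m).relIndex (H.map N.subtype) ≠ 0 := by
    have := (hp.of_injective (Γ := H) (Δ := H.map N.subtype)
      (H.equivMapOfInjective _ N.subtype_injective).symm.toMonoidHom
      (MulEquiv.injective _)).index_powers_ne_zero hm
    refine Subgroup.index_ne_zero_mono ?_ this
    conv_lhs => rw [Subgroup.powers]
    rw [Subgroup.closure_le]
    rintro _ ⟨g, -, rfl⟩
    exact Subgroup.mem_subgroupOf.2 (Subgroup.subset_closure ⟨g, g.2, rfl⟩)
  have h2 : (H.map N.subtype).relIndex N ≠ 0 := by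
    rwa [Subgroup.relIndex, Subgroup.subgroupOf, Subgroup.comap_map_eq_self_of_injective
      N.subtype_injective]
  have h3 := Subgroup.relIndex_ne_zero_trans h1 h2
  refine Subgroup.index_ne_zero_mono ?_ h3
  refine Subgroup.comap_mono ?_
  refine Subgroup.closure_mono (Set.image_mono ?_)
  exact Subgroup.map_subtype_le H

theorem Subgroup.exists_ker_eq_of_isCyclic_quotient {Γ : Type*} [Group Γ] (N : Subgroup Γ)
    [N.Normal] [IsCyclic (Γ ⧸ N)] [Infinite (Γ ⧸ N)] :
    ∃ φ : Γ →* Multiplicative ℤ, φ.ker = N ∧ ∃ x, φ x = Multiplicative.ofAdd 1 := by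
  let e : Multiplicative ℤ ≃* (Γ ⧸ N) := intCyclicMulEquiv
  refine ⟨e.symm.toMonoidHom.comp (QuotientGroup.mk' N), ?_,
    (e.symm.surjective.comp (QuotientGroup.mk'_surjective N)) _⟩
  ext g
  simp

theorem VirtuallyPolyZ.of_isCyclic_quotient {Γ : Type*} [Group Γ] (N : Subgroup Γ) [N.Normal]
    (hc : IsCyclic (Γ ⧸ N)) (h : VirtuallyPolyZ N) : VirtuallyPolyZ Γ := by
  obtain ⟨n, H, hi, hp⟩ := h
  obtain ⟨m, hm, hmH⟩ : ∃ m : ℕ, 0 < m ∧ ∀ g : N, g ^ m ∈ H := by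
    refine ⟨H.index.factorial, Nat.factorial_pos _, fun g =>
      Subgroup.pow_mem_of_index_ne_zero_of_dvd hi g fun k hk hk' => Nat.dvd_factorial hk hk'⟩
  have hPH : N.powers m ≤ H.map N.subtype := by
    rw [Subgroup.powers, Subgroup.closure_le]
    rintro _ ⟨g, hg, rfl⟩
    exact ⟨⟨g, hg⟩ ^ m, hmH _, rfl⟩
  have hP : PolyZ n (N.powers m) := hp.of_injective
      ((H.equivMapOfInjective _ N.subtype_injective).symm.toMonoidHom.comp
        (Subgroup.inclusion hPH))
      ((H.equivMapOfInjective _ N.subtype_injective).symm.injective.comp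
        (Subgroup.inclusion_injective hPH))
  have hPN := N.relIndex_powers_ne_zero hi hp hm
  rcases finite_or_infinite (Γ ⧸ N) with hfin | hinf
  · refine ⟨n, _, ?_, hP⟩
    have : N.relIndex ⊤ ≠ 0 := by
      rw [Subgroup.relIndex_top_right]; exact Subgroup.index_ne_zero_of_finite
    simpa using Subgroup.relIndex_ne_zero_trans hPN this
  · obtain ⟨φ, hφ, x, hx⟩ := N.exists_ker_eq_of_isCyclic_quotient
    have hxg : ∀ g, ∃ j : ℤ, x ^ j * g ∈ N := by
      intro g
      refine ⟨-(φ g).toAdd, ?_⟩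
      rw [← hφ, MonoidHom.mem_ker, map_mul, map_zpow, hx, ← ofAdd_zsmul]
      apply Multiplicative.toAdd.injective
      simp
    have hsup : (N.powers m ⊔ Subgroup.zpowers x) ⊓ N ≤ N.powers m := by
      rintro g ⟨hg, hgN⟩
      obtain ⟨p, hp, _, ⟨j, rfl⟩, rfl⟩ := Subgroup.mem_sup_of_normal_left.1 hg
      have hj : x ^ j ∈ N := (Subgroup.mul_mem_cancel_left N (N.powers_le m hp)).1 hgN
      rw [← hφ, MonoidHom.mem_ker, map_zpow, hx, ← ofAdd_zsmul] at hj
      have : j = 0 := by simpa using hj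
      simpa [this] using hp
    refine ⟨n + 1, N.powers m ⊔ Subgroup.zpowers x, ?_, φ.comp (Subgroup.subtype _), ?_⟩
    · refine Subgroup.index_ne_zero_of_zpow_mul_mem N _ x hxg ?_ one_pos ?_
      · refine Subgroup.index_ne_zero_mono ?_ hPN
        exact Subgroup.comap_mono le_sup_left
      · rw [pow_one]; exact le_sup_right (a := N.powers m) (Subgroup.mem_zpowers x)
    · refine hP.of_injective (((Subgroup.subtype _).comp (Subgroup.subtype _)).codRestrict _
        fun g => hsup ⟨g.1.2, hφ.le g.2⟩) ?_
      · intro a b hab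
        exact Subtype.ext (Subtype.ext (congrArg (Subtype.val : N.powers m → Γ) hab))

theorem virtuallyPolyZ_of_series {G : Type*} [Group G]
    (hpoly : ∃ (k : ℕ) (s : Fin (k + 1) → Subgroup G),
      s 0 = ⊥ ∧ s (Fin.last k) = ⊤ ∧
      ∀ i : Fin k,
        s i.castSucc ≤ s i.succ ∧
        ∃ _ : ((s i.castSucc).subgroupOf (s i.succ)).Normal,
          IsCyclic (↥(s i.succ) ⧸ (s i.castSucc).subgroupOf (s i.succ))) :
    VirtuallyPolyZ G := by
  obtain ⟨k, s, h0, hk, hs⟩ := hpoly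
  have key : ∀ i, VirtuallyPolyZ (s i) := by
    intro i
    induction i using Fin.induction with
    | zero =>
      refine ⟨0, ⊤, by simp, ?_⟩
      rw [h0]
      exact inferInstanceAs (Subsingleton (⊤ : Subgroup (⊥ : Subgroup G)))
    | succ i ih =>
      obtain ⟨hle, hn, hc⟩ := hs i
      exact .of_isCyclic_quotient _ hc (ih.of_mulEquiv (Subgroup.subgroupOfEquivOfLe hle).symm)
  exact (hk ▸ key (Fin.last k)).of_mulEquiv Subgroup.topEquiv

section Triangularization

variable {Γ V : Type*} [Group Γ] [AddCommGroup V] [Module ℂ V]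

/-- The elements of `Γ` having `v` as an eigenvector. -/
def eigenStabilizer (ρ : Γ →* Module.End ℂ V) (v : V) : Subgroup Γ where
  carrier := {g | ∃ μ : ℂ, ρ g v = μ • v}
  one_mem' := ⟨1, by simp⟩
  mul_mem' := by
    rintro a b ⟨μ, hμ⟩ ⟨ν, hν⟩
    exact ⟨ν * μ, by simp [hμ, hν, mul_smul]⟩
  inv_mem' := by
    rintro a ⟨μ, hμ⟩
    have h : ρ a⁻¹ (ρ a v) = v := by
      rw [← Module.End.mul_apply, ← map_mul]; simp
    rw [hμ, map_smul] at h
    refine ⟨μ⁻¹, ?_⟩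
    rcases eq_or_ne μ 0 with rfl | h0
    · rw [zero_smul] at h
      simp [← h]
    · conv_rhs => rw [← h]
      simp [smul_smul, h0]

/-- The elements of `Γ` fixing `v`. -/
def vectorStabilizer (ρ : Γ →* Module.End ℂ V) (v : V) : Subgroup Γ where
  carrier := {g | ρ g v = v}
  one_mem' := by simp
  mul_mem' := by
    intro a b ha hb
    rw [Set.mem_ofPred_eq] at ha hb ⊢
    simp [ha, hb]
  inv_mem' := by
    intro a ha
    rw [Set.mem_ofPred_eq] at ha ⊢
    conv_lhs => rw [← ha]
    rw [← Module.End.mul_apply, ← map_mul]; simp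

theorem exists_character_of_le_eigenStabilizer (ρ : Γ →* Module.End ℂ V) {v : V} (hv : v ≠ 0)
    {P : Subgroup Γ} (hP : P ≤ eigenStabilizer ρ v) :
    ∃ χ : P →* ℂ, ∀ p : P, ρ p v = χ p • v := by
  choose μ hμ using fun p : P => hP p.2
  refine ⟨⟨⟨μ, ?_⟩, ?_⟩, hμ⟩
  · apply smul_left_injective ℂ hv
    simp [← hμ]
  · intro a b
    apply smul_left_injective ℂ hv
    simp only
    rw [← hμ, mul_comm, mul_smul, ← hμ, ← map_smul, ← hμ]
    simp

theorem commutator_le_vectorStabilizer (ρ : Γ →* Module.End ℂ V) {v : V} (hv : v ≠ 0)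
    {P : Subgroup Γ} (hP : P ≤ eigenStabilizer ρ v) : ⁅P, P⁆ ≤ vectorStabilizer ρ v := by
  obtain ⟨χ, hχ⟩ := exists_character_of_le_eigenStabilizer ρ hv hP
  rw [Subgroup.commutator_le]
  intro a ha b hb
  have h := hχ (⟨a, ha⟩ * ⟨b, hb⟩ * ⟨a, ha⟩⁻¹ * ⟨b, hb⟩⁻¹)
  have : χ (⟨a, ha⟩ * ⟨b, hb⟩ * ⟨a, ha⟩⁻¹ * ⟨b, hb⟩⁻¹) = 1 := by
    rw [map_mul, map_mul, map_mul, mul_right_comm (χ _), ← map_mul, mul_assoc,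
      ← map_mul]
    simp
  rw [this, one_smul] at h
  exact h

theorem finite_characters [FiniteDimensional ℂ V] (ρ : Γ →* Module.End ℂ V) :
    {χ : Γ →* ℂ | ∃ v ≠ 0, ∀ g, ρ g v = χ g • v}.Finite := by
  set X := {χ : Γ →* ℂ | ∃ v ≠ 0, ∀ g, ρ g v = χ g • v}
  let ev : Module.Dual ℂ (Module.End ℂ V) →ₗ[ℂ] (Γ → ℂ) :=
    LinearMap.pi fun g => LinearMap.applyₗ (ρ g)
  have hX : ∀ χ : X, (χ.1 : Γ → ℂ) ∈ LinearMap.range ev := by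
    rintro ⟨χ, v, hv, hχ⟩
    obtain ⟨f, hf⟩ := Module.exists_dual_forall_apply_ne_zero (K := ℂ) (fun _ : Unit => v)
      fun _ => hv
    have hf : f v ≠ 0 := hf ()
    refine ⟨(f v)⁻¹ • f ∘ₗ LinearMap.applyₗ v, ?_⟩
    funext g
    simp [ev, hχ, hf, mul_comm]
  have hli : LinearIndependent ℂ (fun χ : X => (⟨χ.1, hX χ⟩ : LinearMap.range ev)) := by
    refine LinearIndependent.of_comp (LinearMap.range ev).subtype ?_
    exact (linearIndependent_monoidHom Γ ℂ).comp _ Subtype.val_injective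
  have := hli.finite
  exact Set.toFinite X

theorem PolyZ.exists_common_eigenvector {n : ℕ} {Γ V : Type*} [Group Γ] [AddCommGroup V]
    [Module ℂ V] [FiniteDimensional ℂ V] [Nontrivial V] (h : PolyZ n Γ)
    (ρ : Γ →* Module.End ℂ V) : ∃ v ≠ 0, (eigenStabilizer ρ v).index ≠ 0 := by
  induction n generalizing Γ with
  | zero =>
    have : Subsingleton Γ := h
    obtain ⟨v, hv⟩ := exists_ne (0 : V)
    exact ⟨v, hv, Subgroup.index_ne_zero_of_finite⟩
  | succ n ih =>
    obtain ⟨φ, hφ⟩ := h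
    obtain ⟨x, hx⟩ := φ.exists_zpow_mul_mem_ker
    obtain ⟨v, hv, hvi⟩ := ih hφ (ρ.comp φ.ker.subtype)
    obtain ⟨m, hm, hmv⟩ : ∃ m : ℕ, 0 < m ∧ ∀ g : φ.ker,
        g ^ m ∈ eigenStabilizer (ρ.comp φ.ker.subtype) v :=
      ⟨_, Nat.factorial_pos _, fun g =>
        Subgroup.pow_mem_of_index_ne_zero_of_dvd hvi g fun k hk hk' => Nat.dvd_factorial hk hk'⟩
    have hPi : (φ.ker.powers m).relIndex φ.ker ≠ 0 :=
      Subgroup.relIndex_powers_ne_zero φ.ker (H := ⊤) (by simp)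
        (hφ.of_injective (Subgroup.subtype _) (Subgroup.subtype_injective _)) hm
    set P := φ.ker.powers m with hPdef
    have hPn : P.Normal := inferInstance
    have hP : P ≤ eigenStabilizer ρ v := by
      rw [hPdef, Subgroup.powers, Subgroup.closure_le]
      rintro _ ⟨g, hg, rfl⟩
      exact hmv ⟨g, hg⟩
    obtain ⟨χ, hχ⟩ := exists_character_of_le_eigenStabilizer ρ hv hP
    let c : Γ →* MulAut P := MulAut.conjNormal
    have hc : ∀ (g : Γ) (p : P) (u : V), ρ p (ρ g u) = ρ g (ρ (c g⁻¹ p : P) u) := by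
      intro g p u
      rw [← Module.End.mul_apply, ← map_mul, ← Module.End.mul_apply, ← map_mul]
      congr 2
      simp [c, mul_assoc]
    have hinj : ∀ (g : Γ) (u : V), u ≠ 0 → ρ g u ≠ 0 := by
      intro g u hu h0
      apply hu
      have : ρ g⁻¹ (ρ g u) = u := by
        rw [← Module.End.mul_apply, ← map_mul]; simp
      rw [← this, h0, map_zero]
    let χs : ℕ → (P →* ℂ) := fun i => χ.comp (c (x ^ i)⁻¹).toMonoidHom
    have hχs : ∀ i (p : P), ρ p (ρ (x ^ i) v) = χs i p • ρ (x ^ i) v := by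
      intro i p
      rw [hc, hχ, map_smul]
      rfl
    obtain ⟨i, j, hij, heq⟩ := Set.Finite.exists_lt_map_eq_of_forall_mem
      (t := {χ : P →* ℂ | ∃ v ≠ 0, ∀ g, ρ.comp P.subtype g v = χ g • v}) (f := χs)
      (fun i => ⟨ρ (x ^ i) v, hinj _ _ hv, hχs i⟩) (finite_characters (ρ.comp P.subtype))
    let U : Submodule ℂ V := ⨅ p : P, Module.End.eigenspace (ρ p) (χs i p)
    have hU : ∀ u, u ∈ U ↔ ∀ p : P, ρ p u = χs i p • u := by
      intro u
      simp only [U, Submodule.mem_iInf, Module.End.mem_eigenspace_iff]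
    have hUx : ∀ u ∈ U, ρ (x ^ (j - i)) u ∈ U := by
      intro u hu
      rw [hU] at hu ⊢
      intro p
      rw [hc, hu, map_smul]
      congr 1
      have h1 : χs i (c (x ^ (j - i))⁻¹ p) = χs j p := by
        have : (x ^ j)⁻¹ = (x ^ i)⁻¹ * (x ^ (j - i))⁻¹ := by
          rw [← mul_inv_rev, ← pow_add]
          congr 2
          omega
        change χ (c (x ^ i)⁻¹ (c (x ^ (j - i))⁻¹ p)) = χ (c (x ^ j)⁻¹ p)
        rw [this, map_mul]
        rfl
      rw [h1, heq]
    have : Nontrivial U := by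
      refine ⟨⟨⟨ρ (x ^ i) v, (hU _).2 (hχs i)⟩, 0, ?_⟩⟩
      intro h
      exact hinj _ _ hv (congrArg Subtype.val h)
    obtain ⟨μ, hμ⟩ := Module.End.exists_eigenvalue ((ρ (x ^ (j - i))).restrict hUx)
    obtain ⟨w, hw, hw0⟩ := hμ.exists_hasEigenvector
    rw [Module.End.mem_eigenspace_iff] at hw
    refine ⟨w, fun h => hw0 (Subtype.ext h), ?_⟩
    refine Subgroup.index_ne_zero_of_zpow_mul_mem φ.ker _ x hx ?_ (Nat.sub_pos_of_lt hij)
      ⟨μ, congrArg Subtype.val hw⟩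
    refine Subgroup.index_ne_zero_mono (Subgroup.comap_mono ?_) hPi
    intro p hp
    exact ⟨_, (hU w).1 w.2 ⟨p, hp⟩⟩

/-- The representation on the quotient by an invariant subspace. -/
def quotientRep (ρ : Γ →* Module.End ℂ V) (W : Submodule ℂ V) (h : ∀ g, W ≤ W.comap (ρ g)) :
    Γ →* Module.End ℂ (V ⧸ W) where
  toFun g := W.mapQ W (ρ g) (h g)
  map_one' := by ext; simp
  map_mul' a b := by ext; simp

theorem PolyZ.exists_commutator_unipotent {n : ℕ} {Γ V : Type*} [Group Γ] [AddCommGroup V]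
    [Module ℂ V] [FiniteDimensional ℂ V] (h : PolyZ n Γ) (ρ : Γ →* Module.End ℂ V) :
    ∃ H : Subgroup Γ, H.index ≠ 0 ∧ ∃ (c : ℕ) (F : ℕ → Submodule ℂ V), F 0 = ⊤ ∧ F c = ⊥ ∧
      ∀ i, ∀ k ∈ ⁅H, H⁆, ∀ v ∈ F i, ρ k v - v ∈ F (i + 1) := by
  induction hd : Module.finrank ℂ V using Nat.strong_induction_on generalizing Γ V with
  | _ d ih =>
  rcases subsingleton_or_nontrivial V with hV | hV
  · exact ⟨⊤, by simp, 0, fun _ => ⊤, rfl, Subsingleton.elim _ _, by simp⟩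
  obtain ⟨v, hv, hQ⟩ := h.exists_common_eigenvector ρ
  set Q := eigenStabilizer ρ v with hQdef
  set W := Submodule.span ℂ {v} with hWdef
  have hW : ∀ g : Q, W ≤ W.comap (ρ g) := by
    intro g
    rw [hWdef, Submodule.span_singleton_le_iff_mem, Submodule.mem_comap]
    obtain ⟨μ, hμ⟩ := g.2
    rw [hμ]
    exact Submodule.smul_mem _ _ (Submodule.mem_span_singleton_self v)
  have hlt : Module.finrank ℂ (V ⧸ W) < d := by
    rw [← hd]
    have h1 := Submodule.finrank_quotient_add_finrank W
    have h2 : Module.finrank ℂ W = 1 := finrank_span_singleton hv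
    omega
  obtain ⟨H', hH', c, F, hF0, hFc, hF⟩ := ih _ hlt
    (h.of_injective Q.subtype Q.subtype_injective) (quotientRep (ρ.comp Q.subtype) W hW) rfl
  have hle : H'.map Q.subtype ≤ Q := Subgroup.map_subtype_le H'
  refine ⟨H'.map Q.subtype, ?_, c + 1,
    fun i => if i ≤ c then (F i).comap W.mkQ else ⊥, by simp [hF0], by simp, ?_⟩
  · rw [Subgroup.index_map_subtype]
    exact mul_ne_zero hH' hQ
  · intro i k hk u hu
    rcases lt_trichotomy i c with hi | rfl | hi
    · simp only [hi.le, if_true, show i + 1 ≤ c from hi, Submodule.mem_comap] at hu ⊢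
      rw [← Subgroup.map_commutator] at hk
      obtain ⟨k, hk, rfl⟩ := hk
      exact hF i k hk _ hu
    · simp only [le_refl, if_true, hFc, Submodule.comap_bot, Submodule.ker_mkQ] at hu
      obtain ⟨a, rfl⟩ := Submodule.mem_span_singleton.1 hu
      have : ρ k v = v := commutator_le_vectorStabilizer ρ hv le_rfl
        (Subgroup.commutator_mono hle hle hk)
      simp [this]
    · simp only [not_le.2 hi, if_false, Submodule.mem_bot] at hu
      simp [hu]

end Triangularization

section Nilpotency

variable {Γ : Type*} [Group Γ]

/-- The conjugation representation of `Γ` on the complex-valued characters of `S`. -/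
def characterRep (S : Subgroup Γ) [S.Normal] : Γ →* Module.End ℂ (Additive S →+ ℂ) where
  toFun g :=
    { toFun := fun f => f.comp (MulAut.conjNormal (H := S) g⁻¹).toMonoidHom.toAdditive
      map_add' := fun _ _ => rfl
      map_smul' := fun _ _ => rfl }
  map_one' := by ext; simp
  map_mul' a b := by ext; simp

/-- The common kernel in `S` of a set of characters of `S`, as a subgroup of the ambient group. -/
def commonKernel (S : Subgroup Γ) (A : Submodule ℂ (Additive S →+ ℂ)) : Subgroup Γ :=
  Subgroup.map S.subtype (⨅ f : A, f.1.toMultiplicativeRight.ker)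

theorem mem_commonKernel {S : Subgroup Γ} {A : Submodule ℂ (Additive S →+ ℂ)} {g : Γ} :
    g ∈ commonKernel S A ↔ ∃ h : g ∈ S, ∀ f ∈ A, f (Additive.ofMul ⟨g, h⟩) = 0 := by
  simp only [commonKernel, Subgroup.mem_map, Subgroup.mem_iInf, MonoidHom.mem_ker]
  constructor
  · rintro ⟨s, hs, rfl⟩
    exact ⟨s.2, fun f hf => congrArg Multiplicative.toAdd (hs ⟨f, hf⟩)⟩
  · rintro ⟨h, hg⟩
    exact ⟨⟨g, h⟩, fun f => congrArg Multiplicative.ofAdd (hg f.1 f.2), rfl⟩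

open scoped commutatorElement in
theorem commutator_commonKernel_le (S : Subgroup Γ) [hS : S.Normal] {K : Subgroup Γ}
    {A B : Submodule ℂ (Additive S →+ ℂ)}
    (h : ∀ k ∈ K, ∀ f ∈ B, characterRep S k f - f ∈ A) :
    ⁅commonKernel S A, K⁆ ≤ commonKernel S B := by
  rw [Subgroup.commutator_le]
  intro d hd k hk
  rw [mem_commonKernel] at hd ⊢
  obtain ⟨hdS, hd⟩ := hd
  have hmem : k * d⁻¹ * k⁻¹ ∈ S := hS.conj_mem _ (S.inv_mem hdS) k
  have hmem' : ⁅d, k⁆ ∈ S := by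
    simpa [commutatorElement_def, mul_assoc] using S.mul_mem hdS hmem
  refine ⟨hmem', fun f hf => ?_⟩
  have h1 := hd _ (h k⁻¹ (K.inv_mem hk) f hf)
  have h2 : f (Additive.ofMul (MulAut.conjNormal (H := S) k⁻¹⁻¹ ⟨d, hdS⟩)) -
      f (Additive.ofMul ⟨d, hdS⟩) = 0 := h1
  have h3 : (⟨⁅d, k⁆, hmem'⟩ : S) = ⟨d, hdS⟩ * (MulAut.conjNormal (H := S) k⁻¹⁻¹ ⟨d, hdS⟩)⁻¹ := by
    ext
    simp [commutatorElement_def, mul_assoc]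
  rw [h3, ofMul_mul, map_add, ofMul_inv, map_neg, ← sub_eq_add_neg, sub_eq_zero]
  exact (sub_eq_zero.1 h2).symm

instance commonKernel_top_normal (S : Subgroup Γ) [hS : S.Normal] : (commonKernel S ⊤).Normal := by
  refine ⟨fun d hd g => ?_⟩
  rw [mem_commonKernel] at hd ⊢
  obtain ⟨hdS, hd⟩ := hd
  exact ⟨hS.conj_mem _ hdS g, fun f _ => hd (f.comp
    (MulAut.conjNormal (H := S) g).toMonoidHom.toAdditive) trivial⟩

theorem PolyZ.commonKernel_top {n : ℕ} (S : Subgroup Γ) (h : PolyZ (n + 1) S) :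
    PolyZ n (commonKernel S ⊤) := by
  obtain ⟨φ, hφ⟩ := h
  have hle : commonKernel S ⊤ ≤ S := fun g hg => (mem_commonKernel.1 hg).1
  refine hφ.of_injective ((Subgroup.inclusion hle).codRestrict φ.ker fun g => ?_) ?_
  · obtain ⟨_, hg⟩ := mem_commonKernel.1 g.2
    have := hg ((Int.castAddHom ℂ).comp φ.toAdditiveLeft) trivial
    simp only [AddMonoidHom.comp_apply, Int.coe_castAddHom, Int.cast_eq_zero] at this
    exact congrArg Multiplicative.ofAdd this
  · intro a b hab
    exact Subgroup.inclusion_injective hle (congrArg Subtype.val hab)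

theorem iterate_commutator_mono {S S' K K' : Subgroup Γ} (hS : S ≤ S') (hK : K ≤ K') (c : ℕ) :
    (fun D => ⁅D, K⁆)^[c] S ≤ (fun D => ⁅D, K'⁆)^[c] S' := by
  induction c with
  | zero => exact hS
  | succ c ih =>
    rw [Function.iterate_succ_apply', Function.iterate_succ_apply']
    exact Subgroup.commutator_mono ih hK

theorem finiteDimensional_characters {S : Type*} [Group S] [Group.FG S] :
    FiniteDimensional ℂ (Additive S →+ ℂ) := by
  obtain ⟨X, hX⟩ := (Group.fg_def (G := S)).1 inferInstance
  let ev : (Additive S →+ ℂ) →ₗ[ℂ] (X → ℂ) :=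
    { toFun := fun f x => f (Additive.ofMul x.1)
      map_add' := fun _ _ => rfl
      map_smul' := fun _ _ => rfl }
  refine FiniteDimensional.of_injective ev ?_
  intro f g hfg
  have : f.toMultiplicativeRight = g.toMultiplicativeRight := by
    refine MonoidHom.eq_of_eqOn_dense hX ?_
    intro x hx
    exact congrArg Multiplicative.ofAdd (congrFun hfg ⟨x, hx⟩)
  exact AddMonoidHom.toMultiplicativeRight.injective this

theorem PolyZ.exists_iterate_commutator_eq_bot {r n : ℕ} (hΓ : PolyZ r Γ) (S : Subgroup Γ)
    [S.Normal] (h : PolyZ n S) : ∃ H : Subgroup Γ, H.index ≠ 0 ∧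
      ∃ c, (fun D => ⁅D, ⁅H, H⁆⁆)^[c] S = ⊥ := by
  induction n generalizing S with
  | zero =>
    have : Subsingleton S := h
    exact ⟨⊤, by simp, 0, Subgroup.eq_bot_of_subsingleton S⟩
  | succ n ih =>
    obtain ⟨H₂, hi₂, c₂, h₂⟩ := ih (commonKernel S ⊤) h.commonKernel_top
    have := h.fg
    have := finiteDimensional_characters (S := S)
    obtain ⟨H₁, hi₁, c₁, F, hF0, hFc, hF⟩ := hΓ.exists_commutator_unipotent (characterRep S)
    refine ⟨H₁ ⊓ H₂, Subgroup.index_inf_ne_zero hi₁ hi₂, c₂ + c₁, ?_⟩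
    have key : ∀ j ≤ c₁, (fun D => ⁅D, ⁅H₁, H₁⁆⁆)^[j] S ≤ commonKernel S (F (c₁ - j)) := by
      intro j
      induction j with
      | zero =>
        intro _ s hs
        refine mem_commonKernel.2 ⟨hs, fun f hf => ?_⟩
        simp only [Nat.sub_zero, hFc, Submodule.mem_bot] at hf
        simp [hf]
      | succ j ihj =>
        intro hj
        rw [Function.iterate_succ_apply']
        refine (Subgroup.commutator_mono (ihj (by omega)) le_rfl).trans ?_
        refine commutator_commonKernel_le S fun k hk f hf => ?_
        rw [show c₁ - j = c₁ - (j + 1) + 1 by omega]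
        exact hF _ k hk f hf
    have h3 := key c₁ le_rfl
    rw [Nat.sub_self, hF0] at h3
    rw [Function.iterate_add_apply, eq_bot_iff, ← h₂]
    refine iterate_commutator_mono ?_ (Subgroup.commutator_mono inf_le_right inf_le_right) _
    exact (iterate_commutator_mono le_rfl
      (Subgroup.commutator_mono inf_le_left inf_le_left) _).trans h3

theorem PolyZ.exists_isNilpotent_commutator {n : ℕ} (h : PolyZ n Γ) :
    ∃ H : Subgroup Γ, H.index ≠ 0 ∧ Group.IsNilpotent ↥⁅H, H⁆ := by
  obtain ⟨H, hi, c, hc⟩ := h.exists_iterate_commutator_eq_bot ⊤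
    (h.of_injective (Subgroup.subtype _) (Subgroup.subtype_injective _))
  refine ⟨H, hi, Subgroup.nilpotent_iff_lowerCentralSeries.2 ⟨c, ?_⟩⟩
  have key : ∀ j, ((⊤ : Subgroup ↥⁅H, H⁆).lowerCentralSeries j).map (Subgroup.subtype _) ≤
      (fun D => ⁅D, ⁅H, H⁆⁆)^[j] (⊤ : Subgroup Γ) := by
    intro j
    induction j with
    | zero => exact le_top
    | succ j ih =>
      rw [Subgroup.lowerCentralSeries_succ, Function.iterate_succ_apply', Subgroup.map_commutator]
      exact Subgroup.commutator_mono ih (Subgroup.map_subtype_le _)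
  have := key c
  rwa [hc, le_bot_iff, Subgroup.map_eq_bot_iff_of_injective _ (Subgroup.subtype_injective _)]
    at this

end Nilpotency

section WeightFiltration

variable {R : Type*} [Ring R]

/-- Membership in the `W`-th term of the filtration of `R` by two-sided ideals generated by
giving the elements of `g w` weight `w`. -/
inductive MemWeight (g : ℕ → Set R) : ℕ → R → Prop
  | base (r : R) : MemWeight g 0 r
  | zero (W : ℕ) : MemWeight g W 0
  | add {W : ℕ} {a b : R} : MemWeight g W a → MemWeight g W b → MemWeight g W (a + b)
  | mul_left {W : ℕ} (r : R) {a : R} : MemWeight g W a → MemWeight g W (r * a)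
  | gen {W v w : ℕ} {a b : R} : a ∈ g w → MemWeight g v b → W ≤ v + w → MemWeight g W (a * b)

namespace MemWeight

variable {g : ℕ → Set R} {v w W : ℕ} {a b r : R}

theorem mono (h : MemWeight g W r) (hv : v ≤ W) : MemWeight g v r := by
  induction h generalizing v with
  | base r => rw [Nat.le_zero.1 hv]; exact base r
  | zero W => exact zero _
  | add _ _ iha ihb => exact (iha hv).add (ihb hv)
  | mul_left r _ ih => exact (ih hv).mul_left r
  | gen ha hb hW => exact gen ha hb (hv.trans hW)

theorem mul (ha : MemWeight g v a) (hb : MemWeight g w b) : MemWeight g (v + w) (a * b) := by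
  induction ha with
  | base r => rw [zero_add]; exact hb.mul_left r
  | zero W => rw [zero_mul]; exact zero _
  | add _ _ iha ihb => rw [add_mul]; exact iha.add ihb
  | mul_left r _ ih => rw [mul_assoc]; exact ih.mul_left r
  | gen ha _ hW ih => rw [mul_assoc]; exact gen ha ih (by omega)

theorem mul_right (ha : MemWeight g W a) (r : R) : MemWeight g W (a * r) :=
  ha.mul (base r)

theorem neg (ha : MemWeight g W a) : MemWeight g W (-a) := by
  simpa using ha.mul_left (-1)

theorem sub (ha : MemWeight g W a) (hb : MemWeight g W b) : MemWeight g W (a - b) := by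
  rw [sub_eq_add_neg]; exact ha.add hb.neg

theorem of_mem (ha : a ∈ g w) : MemWeight g w a := by
  simpa using gen ha (base 1) (zero_add w).ge

theorem map (σ : R →+* R) (hσ : ∀ w, ∀ a ∈ g w, MemWeight g w (σ a)) (h : MemWeight g W r) :
    MemWeight g W (σ r) := by
  induction h with
  | base r => exact base _
  | zero W => rw [map_zero]; exact zero _
  | add _ _ iha ihb => rw [map_add]; exact iha.add ihb
  | mul_left r _ ih => rw [map_mul]; exact ih.mul_left _
  | gen ha _ hW ih => rw [map_mul]; exact ((hσ _ _ ha).mul ih).mono (by omega)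

theorem map_sub_self (σ : R →+* R) (h1 : ∀ r, MemWeight g 1 (σ r - r))
    (hσ : ∀ w, ∀ a ∈ g w, MemWeight g (w + 1) (σ a - a)) (h : MemWeight g W r) :
    MemWeight g (W + 1) (σ r - r) := by
  induction h with
  | base r => exact h1 r
  | zero W => rw [map_zero, sub_zero]; exact zero _
  | add _ _ iha ihb => rw [map_add, add_sub_add_comm]; exact iha.add ihb
  | @mul_left W r a ha ih =>
    rw [show σ (r * a) - r * a = σ r * (σ a - a) + (σ r - r) * a by rw [map_mul]; noncomm_ring]
    exact (ih.mul_left _).add (((h1 r).mul ha).mono (by omega))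
  | @gen W v w a b ha hb hW ih =>
    rw [show σ (a * b) - a * b = σ a * (σ b - b) + (σ a - a) * b by rw [map_mul]; noncomm_ring]
    have h2 : MemWeight g w (σ a) := by
      simpa using (of_mem ha).add ((hσ w a ha).mono (Nat.le_succ w))
    exact ((h2.mul ih).mono (by omega)).add (((hσ w a ha).mul hb).mono (by omega))

theorem apply_mem {M : Type*} [AddCommGroup M] (Θ : R →+* Module.End ℤ M) {F : ℕ → Submodule ℤ M}
    (hF : ∀ r i, ∀ m ∈ F i, Θ r m ∈ F i) {s : ℕ} (hs0 : 0 < s)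
    (hs : ∀ w, s < w → ∀ a ∈ g w, Θ a = 0)
    (hg : ∀ w, ∀ a ∈ g w, ∀ i, ∀ m ∈ F i, Θ a m ∈ F (i + 1)) (h : MemWeight g W r) :
    ∀ k, s * k ≤ W → ∀ i, ∀ m ∈ F i, Θ r m ∈ F (i + k) := by
  induction h with
  | base r =>
    intro k hk i m hm
    obtain rfl : k = 0 := by simpa [hs0.ne'] using hk
    exact hF r i m hm
  | zero W => intro k _ i m _; simp
  | add _ _ iha ihb =>
    intro k hk i m hm
    rw [map_add]
    exact add_mem (iha k hk i m hm) (ihb k hk i m hm)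
  | mul_left r _ ih =>
    intro k hk i m hm
    rw [map_mul]
    exact hF _ _ _ (ih k hk i m hm)
  | @gen W v w a b ha hb hW ih =>
    intro k hk i m hm
    rw [map_mul]
    rcases lt_or_ge s w with h | h
    · simp [hs w h a ha]
    · cases k with
      | zero => exact hF _ _ _ (hF _ _ _ hm)
      | succ k => exact hg w a ha _ _ (ih k (by rw [Nat.mul_succ] at hk; omega) i m hm)

end MemWeight

/-- The `W`-th term of the filtration of `R` determined by the weighted elements `g`. -/
def weightIdeal (g : ℕ → Set R) (W : ℕ) : Ideal R where
  carrier := {r | MemWeight g W r}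
  zero_mem' := .zero W
  add_mem' := .add
  smul_mem' r _ := .mul_left r

/-- A left ideal `P` is cofinite if `R` is generated by `P` and a finite set as a group. -/
def Ideal.IsCofinite (P : Ideal R) : Prop :=
  ∃ S : Finset R, P.restrictScalars ℤ ⊔ Submodule.span ℤ (S : Set R) = ⊤

theorem Ideal.IsCofinite.fg {P : Ideal R} (hP : P.IsCofinite) (X : Finset R)
    (hX : ∀ A : Submodule ℤ R, 1 ∈ A → (∀ x ∈ X, ∀ a ∈ A, x * a ∈ A) → A = ⊤) : P.FG := by
  classical
  obtain ⟨S, hS⟩ := hP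
  have hdec : ∀ r : R, ∃ p ∈ P, ∃ s ∈ Submodule.span ℤ (S : Set R), p + s = r := fun r =>
    Submodule.mem_sup.1 (hS ▸ Submodule.mem_top : r ∈ P.restrictScalars ℤ ⊔ _)
  choose p hp s hs hps using hdec
  let Y : Finset R := insert 1 (Finset.image₂ (· * ·) X S)
  let P' : Ideal R := Submodule.span R (p '' Y)
  have hP' : P' ≤ P := Submodule.span_le.2 (by rintro _ ⟨r, -, rfl⟩; exact hp r)
  have hY : ∀ r ∈ Y, r ∈ P'.restrictScalars ℤ ⊔ Submodule.span ℤ (S : Set R) := fun r hr =>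
    Submodule.mem_sup.2 ⟨p r, Submodule.subset_span ⟨r, hr, rfl⟩, s r, hs r, hps r⟩
  have htop : P'.restrictScalars ℤ ⊔ Submodule.span ℤ (S : Set R) = ⊤ := by
    refine hX _ (hY 1 (Finset.mem_insert_self _ _)) fun x hx a ha => ?_
    obtain ⟨b, hb, c, hc, rfl⟩ := Submodule.mem_sup.1 ha
    rw [mul_add]
    refine add_mem (Submodule.mem_sup_left (P'.smul_mem x hb)) ?_
    clear ha
    induction hc using Submodule.span_induction with
    | mem c hc => exact hY _ (Finset.mem_insert_of_mem (Finset.mem_image₂_of_mem hx hc))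
    | zero => simp
    | add c d _ _ ihc ihd => rw [mul_add]; exact add_mem ihc ihd
    | smul n c _ ih => rw [mul_smul_comm]; exact Submodule.smul_mem _ n ih
  have : IsNoetherian ℤ (Submodule.span ℤ (S : Set R)) :=
    isNoetherian_span_of_finite ℤ S.finite_toSet
  have hfg : (P.restrictScalars ℤ ⊓ Submodule.span ℤ (S : Set R)).FG :=
    Submodule.FG.of_le_of_isNoetherian inf_le_right
  obtain ⟨Z, hZ⟩ := hfg
  refine ⟨Y.image p ∪ Z, ?_⟩
  rw [Finset.coe_union, Ideal.span, Submodule.span_union, Finset.coe_image]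
  refine le_antisymm (sup_le hP' (Submodule.span_le.2 fun z hz => ?_)) fun r hr => ?_
  · have : z ∈ Submodule.span ℤ (Z : Set R) := Submodule.subset_span hz
    rw [hZ] at this
    exact this.1
  · obtain ⟨a, ha, b, hb, rfl⟩ :=
      Submodule.mem_sup.1 (htop ▸ Submodule.mem_top : r ∈ P'.restrictScalars ℤ ⊔ _)
    refine add_mem (Submodule.mem_sup_left ha) (Submodule.mem_sup_right ?_)
    have hbP : b ∈ P := by simpa using sub_mem hr (hP' ha)
    have : b ∈ Submodule.span ℤ (Z : Set R) := hZ ▸ ⟨hbP, hb⟩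
    exact Submodule.span_le_restrictScalars ℤ R _ this

theorem isCofinite_weightIdeal {g : ℕ → Set R} (h1 : (weightIdeal g 1).IsCofinite) (X : Finset R)
    (hX : ∀ A : Submodule ℤ R, 1 ∈ A → (∀ x ∈ X, ∀ a ∈ A, x * a ∈ A) → A = ⊤) (W : ℕ) :
    (weightIdeal g W).IsCofinite := by
  classical
  induction W with
  | zero => exact ⟨∅, eq_top_iff.2 fun r _ => Submodule.mem_sup_left (MemWeight.base r)⟩
  | succ W ih =>
    obtain ⟨Y, hY⟩ := ih.fg X hX
    obtain ⟨S₁, hS₁⟩ := h1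
    obtain ⟨S₂, hS₂⟩ := ih
    refine ⟨Finset.image₂ (· * ·) S₁ Y ∪ S₂, ?_⟩
    rw [Finset.coe_union, Submodule.span_union, ← sup_assoc, eq_top_iff, ← hS₂]
    refine sup_le_sup_right ?_ _
    intro r hr
    change r ∈ weightIdeal g W at hr
    rw [← hY] at hr
    obtain ⟨f, -, rfl⟩ := Submodule.mem_span_finset.1 hr
    refine sum_mem fun y hy => ?_
    obtain ⟨a, ha, b, hb, hab⟩ := Submodule.mem_sup.1
      (hS₁ ▸ Submodule.mem_top : f y ∈ (weightIdeal g 1).restrictScalars ℤ ⊔ _)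
    have hyW : y ∈ weightIdeal g W := hY ▸ Submodule.subset_span hy
    rw [← hab, smul_eq_mul, add_mul]
    refine add_mem (Submodule.mem_sup_left ((MemWeight.mul ha hyW).mono (by omega))) ?_
    refine Submodule.mem_sup_right ?_
    clear hab
    induction hb using Submodule.span_induction with
    | mem c hc => exact Submodule.subset_span (Finset.mem_image₂_of_mem hc hy)
    | zero => simp
    | add c d _ _ ihc ihd => rw [add_mul]; exact add_mem ihc ihd
    | smul n c _ ih => rw [smul_mul_assoc]; exact Submodule.smul_mem _ n ih

end WeightFiltration

section Representations

variable {T T' M M' : Type*} [Group T] [Group T'] [AddCommGroup M] [AddCommGroup M']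

/-- The representation `ρ` has a finite filtration on whose factors `L` acts trivially. -/
def IsNilRep (L : Subgroup T) (ρ : T →* Module.End ℤ M) : Prop :=
  ∃ (c : ℕ) (F : ℕ → Submodule ℤ M), Antitone F ∧ F 0 = ⊤ ∧ F c = ⊥ ∧
    (∀ t i, ∀ m ∈ F i, ρ t m ∈ F i) ∧ ∀ k ∈ L, ∀ i, ∀ m ∈ F i, ρ k m - m ∈ F (i + 1)

/-- `T` has a faithful integral representation that is unipotent on `L`. -/
def HasNilRep (T : Type*) [Group T] (L : Subgroup T) : Prop :=
  ∃ (n : ℕ) (ρ : T →* Module.End ℤ (Fin n → ℤ)), Function.Injective ρ ∧ IsNilRep L ρ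

theorem HasNilRep.of_rep [Module.Free ℤ M] [Module.Finite ℤ M] {L : Subgroup T}
    (ρ : T →* Module.End ℤ M) (hρ : Function.Injective ρ) (h : IsNilRep L ρ) : HasNilRep T L := by
  let e : M ≃ₗ[ℤ] (Fin (Module.finrank ℤ M) → ℤ) := (Module.finBasis ℤ M).equivFun
  refine ⟨_, e.conjRingEquiv.toRingHom.toMonoidHom.comp ρ, ?_, ?_⟩
  · exact e.conjRingEquiv.injective.comp hρ
  · obtain ⟨c, F, hF, h0, hc, hst, hL⟩ := h
    refine ⟨c, fun i => (F i).comap e.symm.toLinearMap, fun i j hij =>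
      Submodule.comap_mono (hF hij), by simp [h0], ?_, fun t i m hm => ?_, fun k hk i m hm => ?_⟩
    · dsimp only
      rw [hc, Submodule.comap_bot, LinearEquiv.ker]
    · simpa using hst t i _ hm
    · simpa using hL k hk i _ hm

theorem HasNilRep.comap {L : Subgroup T} (h : HasNilRep T L) (f : T' →* T)
    (hf : Function.Injective f) {L' : Subgroup T'} (hL : L'.map f ≤ L) : HasNilRep T' L' := by
  obtain ⟨n, ρ, hρ, c, F, hF, h0, hc, hst, hk⟩ := h
  exact ⟨n, ρ.comp f, hρ.comp hf, c, F, hF, h0, hc, fun t => hst (f t),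
    fun k hk' => hk (f k) (hL ⟨k, hk', rfl⟩)⟩

theorem HasNilRep.mono {L L' : Subgroup T} (h : HasNilRep T L) (hL : L' ≤ L) : HasNilRep T L' :=
  h.comap (MonoidHom.id T) Function.injective_id (by rwa [Subgroup.map_id])

/-- The direct sum of two representations. -/
def prodRep (ρ : T →* Module.End ℤ M) (ρ' : T →* Module.End ℤ M') :
    T →* Module.End ℤ (M × M') where
  toFun t := (ρ t).prodMap (ρ' t)
  map_one' := by ext <;> simp
  map_mul' a b := by ext <;> simp

theorem IsNilRep.prod {L : Subgroup T} {ρ : T →* Module.End ℤ M} {ρ' : T →* Module.End ℤ M'}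
    (h : IsNilRep L ρ) (h' : IsNilRep L ρ') : IsNilRep L (prodRep ρ ρ') := by
  obtain ⟨c, F, hF, h0, hc, hst, hL⟩ := h
  obtain ⟨c', F', hF', h0', hc', hst', hL'⟩ := h'
  refine ⟨max c c', fun i => (F i).prod (F' i), fun i j hij =>
      Submodule.prod_mono (hF hij) (hF' hij),
    by simp [h0, h0'], ?_, fun t i m hm => ⟨hst t i _ hm.1, hst' t i _ hm.2⟩,
    fun k hk i m hm => ⟨hL k hk i _ hm.1, hL' k hk i _ hm.2⟩⟩
  have h1 : F (max c c') = ⊥ := eq_bot_iff.2 ((hF (le_max_left c c')).trans hc.le)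
  have h2 : F' (max c c') = ⊥ := eq_bot_iff.2 ((hF' (le_max_right c c')).trans hc'.le)
  simp [h1, h2]

theorem HasNilRep.of_prod [Module.Free ℤ M] [Module.Finite ℤ M] [Module.Free ℤ M']
    [Module.Finite ℤ M'] {L : Subgroup T} {ρ : T →* Module.End ℤ M} {ρ' : T →* Module.End ℤ M'}
    (h : IsNilRep L ρ) (h' : IsNilRep L ρ') (hρ : ∀ t, ρ t = 1 → ρ' t = 1 → t = 1) :
    HasNilRep T L := by
  refine HasNilRep.of_rep (prodRep ρ ρ') ?_ (h.prod h')
  rw [injective_iff_map_eq_one]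
  intro t ht
  refine hρ t (LinearMap.ext fun m => ?_) (LinearMap.ext fun m => ?_)
  · exact congrArg Prod.fst (LinearMap.congr_fun ht (m, 0))
  · exact congrArg Prod.snd (LinearMap.congr_fun ht (0, m))

/-- The two-dimensional unipotent representation attached to a homomorphism to `ℤ`. -/
def shearRep (φ : T →* Multiplicative ℤ) : T →* Module.End ℤ (ℤ × ℤ) where
  toFun t := LinearMap.id + (LinearMap.inl ℤ ℤ ℤ) ∘ₗ ((φ t).toAdd • LinearMap.snd ℤ ℤ ℤ)
  map_one' := by ext <;> simp
  map_mul' a b := by ext <;> simp; ring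

theorem shearRep_apply (φ : T →* Multiplicative ℤ) (t : T) (m : ℤ × ℤ) :
    shearRep φ t m = (m.1 + (φ t).toAdd * m.2, m.2) := by
  ext <;> simp [shearRep]

theorem isNilRep_shearRep (φ : T →* Multiplicative ℤ) (L : Subgroup T) :
    IsNilRep L (shearRep φ) := by
  refine ⟨2, fun i => if i = 0 then ⊤ else if i = 1 then LinearMap.ker (LinearMap.snd ℤ ℤ ℤ) else ⊥,
    ?_, rfl, rfl, ?_, ?_⟩
  · refine antitone_nat_of_succ_le fun i => ?_
    rcases i with _ | _ | i <;> simp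
  · intro t i m
    rcases i with _ | _ | i
    · simp
    · simp [shearRep_apply]
    · simp +contextual
  · intro k _ i m
    rcases i with _ | _ | i
    · simp [shearRep_apply]
    · intro hm
      have hm : m.2 = 0 := hm
      simp [shearRep_apply, Prod.ext_iff, hm]
    · simp +contextual

theorem shearRep_eq_one {φ : T →* Multiplicative ℤ} {t : T} (h : shearRep φ t = 1) : φ t = 1 := by
  have := congrArg Prod.fst (LinearMap.congr_fun h (0, 1))
  simpa [shearRep_apply] using this

/-- The elements having a nonzero multiple in `P`. -/
def isolator (P : Submodule ℤ M) : Submodule ℤ M where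
  carrier := {m | ∃ k : ℤ, k ≠ 0 ∧ k • m ∈ P}
  zero_mem' := ⟨1, one_ne_zero, by simp⟩
  add_mem' := by
    rintro a b ⟨k, hk, ha⟩ ⟨l, hl, hb⟩
    refine ⟨k * l, mul_ne_zero hk hl, ?_⟩
    rw [smul_add]
    refine add_mem ?_ ?_
    · rw [mul_comm, mul_smul]; exact P.smul_mem _ ha
    · rw [mul_smul]; exact P.smul_mem _ hb
  smul_mem' := by
    rintro n a ⟨k, hk, ha⟩
    exact ⟨k, hk, by rw [smul_comm]; exact P.smul_mem _ ha⟩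

theorem le_isolator (P : Submodule ℤ M) : P ≤ isolator P :=
  fun m hm => ⟨1, one_ne_zero, by simpa using hm⟩

theorem isolator_mono {P Q : Submodule ℤ M} (h : P ≤ Q) : isolator P ≤ isolator Q := by
  rintro m ⟨k, hk, hm⟩
  exact ⟨k, hk, h hm⟩

theorem map_mem_isolator {P : Submodule ℤ M} {Q : Submodule ℤ M'} (f : M →ₗ[ℤ] M')
    (h : ∀ m ∈ P, f m ∈ Q) {m : M} (hm : m ∈ isolator P) : f m ∈ isolator Q := by
  obtain ⟨k, hk, hm⟩ := hm
  exact ⟨k, hk, by rw [← map_smul]; exact h _ hm⟩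

instance isTorsionFree_isolator (P : Submodule ℤ M) : Module.IsTorsionFree ℤ (M ⧸ isolator P) := by
  refine .of_smul_eq_zero fun k m hm => ?_
  obtain ⟨m, rfl⟩ := Submodule.Quotient.mk_surjective _ m
  rw [← Submodule.Quotient.mk_smul, Submodule.Quotient.mk_eq_zero] at hm
  rw [Submodule.Quotient.mk_eq_zero, or_iff_not_imp_left]
  intro hk
  obtain ⟨l, hl, hm⟩ := hm
  exact ⟨l * k, mul_ne_zero hl hk, by rwa [mul_smul]⟩

theorem exists_isNilRep_quotient {L : Subgroup T} (ρ : T →* Module.End ℤ M)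
    (P : ℕ → Submodule ℤ M) (hP : Antitone P) (h0 : P 0 = ⊤)
    (hst : ∀ t i, ∀ m ∈ P i, ρ t m ∈ P i)
    (hL : ∀ k ∈ L, ∀ i, ∀ m ∈ P i, ρ k m - m ∈ P (i + 1)) (c : ℕ) :
    ∃ ρ' : T →* Module.End ℤ (M ⧸ isolator (P c)), IsNilRep L ρ' ∧
      ∀ t, ρ' t = 1 → ∀ m, ρ t m - m ∈ isolator (P c) := by
  have hle : ∀ t, isolator (P c) ≤ (isolator (P c)).comap (ρ t) :=
    fun t m hm => map_mem_isolator (ρ t) (hst t c) hm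
  refine ⟨⟨⟨fun t => (isolator (P c)).mapQ _ (ρ t) (hle t), ?_⟩, ?_⟩, ⟨c, fun i =>
    (isolator (P i)).map (isolator (P c)).mkQ, ?_, ?_, ?_, ?_, ?_⟩, ?_⟩
  · ext; simp
  · intro a b; ext; simp
  · exact fun i j hij => Submodule.map_mono (isolator_mono (hP hij))
  · dsimp only
    rw [h0, top_le_iff.1 (le_isolator (⊤ : Submodule ℤ M)), Submodule.map_top,
      Submodule.range_mkQ]
  · exact (Submodule.mkQ_map_self _)
  · rintro t i _ ⟨m, hm, rfl⟩
    exact ⟨ρ t m, map_mem_isolator (ρ t) (hst t i) hm, rfl⟩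
  · rintro k hk i _ ⟨m, hm, rfl⟩
    exact ⟨ρ k m - m, map_mem_isolator (ρ k - 1) (hL k hk i) hm, rfl⟩
  · intro t ht m
    have := LinearMap.congr_fun ht ((isolator (P c)).mkQ m)
    exact (Submodule.Quotient.eq _).1 this

end Representations

section GroupRing

open MonoidAlgebra

theorem submodule_eq_top_of_forall_of_mem {N : Type*} [Monoid N]
    (A : Submodule ℤ (MonoidAlgebra ℤ N)) (h : ∀ n, of ℤ N n ∈ A) (r : MonoidAlgebra ℤ N) : r ∈ A :=
  MonoidAlgebra.induction_on r h (fun _ _ => add_mem) fun k _ => A.smul_mem k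

theorem exists_finset_generating_groupRing (N : Type*) [Group N] [Group.FG N] :
    ∃ X : Finset (MonoidAlgebra ℤ N), ∀ A : Submodule ℤ (MonoidAlgebra ℤ N), 1 ∈ A →
      (∀ x ∈ X, ∀ a ∈ A, x * a ∈ A) → A = ⊤ := by
  classical
  obtain ⟨S, hS⟩ := (Group.fg_iff_monoid_fg.1 ‹Group.FG N›).fg_top
  refine ⟨S.image (of ℤ N), fun A h1 hA => eq_top_iff.2 fun r _ =>
    submodule_eq_top_of_forall_of_mem A (fun n => ?_) r⟩
  have hn : n ∈ Submonoid.closure (S : Set N) := hS ▸ Submonoid.mem_top n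
  induction hn using Submonoid.closure_induction_left with
  | one => rwa [map_one]
  | mul_left x hx y _ ih =>
    rw [map_mul]
    exact hA _ (Finset.mem_image_of_mem _ hx) _ ih

variable {T : Type*} [Group T]

/-- The automorphism of the group ring of a normal subgroup induced by conjugation. -/
noncomputable def conjGroupRing (N : Subgroup T) [N.Normal] (t : T) :
    MonoidAlgebra ℤ N →+* MonoidAlgebra ℤ N :=
  mapDomainRingHom ℤ (MulAut.conjNormal (H := N) t).toMonoidHom

@[simp]
theorem conjGroupRing_of (N : Subgroup T) [N.Normal] (t : T) (n : N) :
    conjGroupRing N t (of ℤ N n) = of ℤ N (MulAut.conjNormal t n) := by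
  simp [conjGroupRing]

variable (φ : T →* Multiplicative ℤ) {x : T} (hx : φ x = Multiplicative.ofAdd 1)

/-- The component in `φ.ker` of `t` with respect to the complement generated by `x`. -/
def kerPart (t : T) : φ.ker :=
  ⟨t * x ^ (-(φ t).toAdd), by
    rw [MonoidHom.mem_ker, map_mul, map_zpow, hx, ← ofAdd_zsmul]
    apply Multiplicative.toAdd.injective
    simp⟩

theorem kerPart_mul (a b : T) :
    kerPart φ hx (a * b) = MulAut.conjNormal a (kerPart φ hx b) * kerPart φ hx a := by
  ext
  simp only [kerPart, map_mul, toAdd_mul, Subgroup.coe_mul, MulAut.conjNormal_apply, neg_add,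
    zpow_add]
  group

theorem kerPart_of_mem {t : T} (ht : t ∈ φ.ker) : kerPart φ hx t = ⟨t, ht⟩ := by
  ext
  simp [kerPart, MonoidHom.mem_ker.1 ht]

/-- The action of `T` on the group ring of `φ.ker`, seen as the free abelian group on the left
cosets of the subgroup generated by `x`. -/
noncomputable def groupRingRep : T →* Module.End ℤ (MonoidAlgebra ℤ φ.ker) where
  toFun t := LinearMap.mulRight ℤ (of ℤ φ.ker (kerPart φ hx t)) ∘ₗ
    (conjGroupRing φ.ker t).toAddMonoidHom.toIntLinearMap
  map_one' := by
    refine LinearMap.ext fun r => ?_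
    refine LinearMap.mem_eqLocus.1
      (submodule_eq_top_of_forall_of_mem (LinearMap.eqLocus _ _) ?_ r)
    intro n
    change conjGroupRing φ.ker 1 (of ℤ φ.ker n) * of ℤ φ.ker (kerPart φ hx 1) = of ℤ φ.ker n
    rw [conjGroupRing_of, ← map_mul, kerPart_of_mem φ hx (one_mem _)]
    congr 1
    ext
    simp
  map_mul' a b := by
    refine LinearMap.ext fun r => ?_
    refine LinearMap.mem_eqLocus.1
      (submodule_eq_top_of_forall_of_mem (LinearMap.eqLocus _ _) ?_ r)
    intro n
    change conjGroupRing φ.ker (a * b) (of ℤ φ.ker n) * of ℤ φ.ker (kerPart φ hx (a * b)) =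
      conjGroupRing φ.ker a (conjGroupRing φ.ker b (of ℤ φ.ker n) * of ℤ φ.ker (kerPart φ hx b)) *
        of ℤ φ.ker (kerPart φ hx a)
    rw [map_mul]
    simp only [conjGroupRing_of, ← map_mul, kerPart_mul]
    simp [mul_assoc]

theorem groupRingRep_apply (t : T) (r : MonoidAlgebra ℤ φ.ker) :
    groupRingRep φ hx t r = conjGroupRing φ.ker t r * of ℤ φ.ker (kerPart φ hx t) := rfl

theorem groupRingRep_apply_of_mem (n : φ.ker) (r : MonoidAlgebra ℤ φ.ker) :
    groupRingRep φ hx n r = of ℤ φ.ker n * r := by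
  refine (LinearMap.mem_eqLocus).1 (submodule_eq_top_of_forall_of_mem
    (LinearMap.eqLocus (groupRingRep φ hx n) (LinearMap.mulLeft ℤ (of ℤ φ.ker n))) ?_ r)
  intro m
  change conjGroupRing φ.ker n (of ℤ φ.ker m) * of ℤ φ.ker (kerPart φ hx n) =
    of ℤ φ.ker n * of ℤ φ.ker m
  rw [conjGroupRing_of, ← map_mul, ← map_mul, kerPart_of_mem φ hx n.2]
  congr 1
  ext
  simp

end GroupRing

section Extension

open MonoidAlgebra

variable {T : Type*} [Group T] (φ : T →* Multiplicative ℤ) {x : T}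

theorem MemWeight.of_forall_of {N R : Type*} [Group N] [Ring R] {g : ℕ → Set R} {W : ℕ}
    (f : MonoidAlgebra ℤ N →ₗ[ℤ] R) (h : ∀ n, MemWeight g W (f (of ℤ N n)))
    (r : MonoidAlgebra ℤ N) : MemWeight g W (f r) :=
  submodule_eq_top_of_forall_of_mem (((weightIdeal g W).restrictScalars ℤ).comap f) h r

theorem finite_quotient_of_isCofinite {R : Type*} [Ring R] {P : Ideal R} (hP : P.IsCofinite)
    {Q : Submodule ℤ R} (hQ : P.restrictScalars ℤ ≤ Q) : Module.Finite ℤ (R ⧸ Q) := by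
  obtain ⟨S, hS⟩ := hP
  refine ⟨?_⟩
  have h1 : (Submodule.span ℤ (S : Set R)).map Q.mkQ = ⊤ := by
    rw [eq_top_iff, ← Q.range_mkQ, LinearMap.range_eq_map, ← hS, Submodule.map_sup]
    refine sup_le ?_ le_rfl
    refine (Submodule.map_mono hQ).trans ?_
    rw [Submodule.mkQ_map_self]
    exact bot_le
  rw [← h1]
  exact (Submodule.fg_span S.finite_toSet).map _

theorem isCofinite_of_linearMap {R M : Type*} [Ring R] [AddCommGroup M] [IsNoetherian ℤ M]
    {P : Ideal R} (f : R →ₗ[ℤ] M) (h : ∀ r, f r = 0 → r ∈ P) : P.IsCofinite := by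
  classical
  obtain ⟨Z, hZ⟩ := IsNoetherian.noetherian (LinearMap.range f)
  have hsub : (Z : Set M) ⊆ f '' Set.univ := by
    rw [Set.image_univ]
    exact fun z hz => hZ.le (Submodule.subset_span hz)
  obtain ⟨S, -, rfl⟩ := Finset.subset_set_image_iff.1 hsub
  refine ⟨S, eq_top_iff.2 fun r _ => ?_⟩
  have : f r ∈ (Submodule.span ℤ (S : Set R)).map f := by
    rw [Submodule.map_span, ← Finset.coe_image, hZ]
    exact ⟨r, rfl⟩
  obtain ⟨s, hs, hsr⟩ := this
  rw [← sub_add_cancel r s]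
  refine add_mem (Submodule.mem_sup_left (h _ ?_)) (Submodule.mem_sup_right hs)
  rw [map_sub, hsr, sub_self]

theorem HasNilRep.of_memWeight [Group.FG φ.ker] (hx : φ x = Multiplicative.ofAdd 1)
    {L : Subgroup T} (g : ℕ → Set (MonoidAlgebra ℤ φ.ker)) (h1 : (weightIdeal g 1).IsCofinite)
    (hσ : ∀ t w, ∀ a ∈ g w, MemWeight g w (conjGroupRing φ.ker t a))
    (hL : ∀ k ∈ L, ∀ W r, MemWeight g W r → MemWeight g (W + 1) (groupRingRep φ hx k r - r))
    {M : Type*} [AddCommGroup M] [Module.IsTorsionFree ℤ M]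
    (Θ : MonoidAlgebra ℤ φ.ker →+* Module.End ℤ M) (hΘ : ∀ n, Θ (of ℤ _ n) = 1 → n = 1)
    (c : ℕ) (hc : ∀ r, MemWeight g c r → Θ r = 0) : HasNilRep T L := by
  obtain ⟨X, hX⟩ := exists_finset_generating_groupRing φ.ker
  obtain ⟨ρ, hρ, hρ1⟩ := exists_isNilRep_quotient (L := L) (groupRingRep φ hx)
    (fun i => (weightIdeal g i).restrictScalars ℤ)
    (fun i j hij r hr => MemWeight.mono hr hij) (eq_top_iff.2 fun r _ => MemWeight.base r)
    (fun t i r hr => (MemWeight.map _ (hσ t) hr).mul_right _)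
    (fun k hk i r hr => hL k hk i r hr) c
  have : Module.Finite ℤ (MonoidAlgebra ℤ φ.ker ⧸
      isolator ((weightIdeal g c).restrictScalars ℤ)) :=
    finite_quotient_of_isCofinite (isCofinite_weightIdeal h1 X hX c) (le_isolator _)
  refine HasNilRep.of_prod hρ (isNilRep_shearRep φ L) fun t ht ht' => ?_
  have htk : t ∈ φ.ker := shearRep_eq_one ht'
  obtain ⟨k, hk, hm⟩ := hρ1 t ht 1
  rw [show t = ((⟨t, htk⟩ : φ.ker) : T) from rfl, groupRingRep_apply_of_mem, mul_one] at hm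
  have h2 := hc _ hm
  rw [map_zsmul, map_sub, map_one] at h2
  have h3 : Θ (of ℤ _ (⟨t, htk⟩ : φ.ker)) = 1 := by
    refine LinearMap.ext fun m => sub_eq_zero.1 ?_
    have := LinearMap.congr_fun h2 m
    exact (smul_eq_zero.1 this).resolve_left hk
  exact congrArg Subtype.val (hΘ _ h3)

theorem lift_mem_of_stable {N M : Type*} [Group N] [AddCommGroup M] (ρ : N →* Module.End ℤ M)
    (F : Submodule ℤ M) (hF : ∀ n, ∀ m ∈ F, ρ n m ∈ F) (r : MonoidAlgebra ℤ N) {m : M}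
    (hm : m ∈ F) : lift ℤ (Module.End ℤ M) N ρ r m ∈ F := by
  refine submodule_eq_top_of_forall_of_mem (F.comap ((LinearMap.applyₗ m) ∘ₗ
    (lift ℤ (Module.End ℤ M) N ρ).toLinearMap)) (fun n => ?_) r
  simpa using hF n m hm

theorem HasNilRep.of_isNilpotent [Group.FG φ.ker] (hx : φ x = Multiplicative.ofAdd 1)
    (hT : Group.IsNilpotent T) (h : HasNilRep φ.ker ⊤) : HasNilRep T ⊤ := by
  obtain ⟨n, ρ, hρ, c, F, hF, h0, hc, hst, hk⟩ := h
  obtain ⟨s, hs⟩ := Subgroup.nilpotent_iff_lowerCentralSeries.1 hT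
  let g : ℕ → Set (MonoidAlgebra ℤ φ.ker) := fun w =>
    {a | 1 ≤ w ∧ ∃ γ : φ.ker, (γ : T) ∈ (⊤ : Subgroup T).lowerCentralSeries (w - 1) ∧
      a = of ℤ _ γ - 1}
  have hg1 : ∀ γ, MemWeight g 1 (of ℤ φ.ker γ - 1) := fun γ =>
    .of_mem ⟨le_rfl, γ, Subgroup.mem_top _, rfl⟩
  have hσ1 : ∀ t r, MemWeight g 1 (conjGroupRing φ.ker t r - r) := by
    intro t
    refine MemWeight.of_forall_of
      ((conjGroupRing φ.ker t).toAddMonoidHom.toIntLinearMap - LinearMap.id) fun γ => ?_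
    change MemWeight g 1 (conjGroupRing φ.ker t (of ℤ _ γ) - of ℤ _ γ)
    rw [conjGroupRing_of, ← sub_sub_sub_cancel_right _ _ 1]
    exact (hg1 _).sub (hg1 _)
  have hσ : ∀ t w, ∀ a ∈ g w, MemWeight g (w + 1) (conjGroupRing φ.ker t a - a) := by
    rintro t w _ ⟨hw, γ, hγ, rfl⟩
    have : conjGroupRing φ.ker t (of ℤ _ γ - 1) - (of ℤ _ γ - 1) =
        (of ℤ _ (MulAut.conjNormal t γ * γ⁻¹) - 1) * of ℤ _ γ := by
      rw [sub_mul, ← map_mul, inv_mul_cancel_right, map_sub, map_one, conjGroupRing_of, one_mul,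
        sub_sub_sub_cancel_right]
    rw [this]
    refine MemWeight.mul_right (MemWeight.of_mem (g := g) (w := w + 1) ?_) _
    refine ⟨by omega, _, ?_, rfl⟩
    obtain ⟨w, rfl⟩ := Nat.exists_eq_add_of_le' hw
    have h2 := inv_mem (Subgroup.commutator_mem_commutator hγ (Subgroup.mem_top t))
    rw [commutatorElement_inv] at h2
    exact h2
  refine HasNilRep.of_memWeight φ hx g ⟨{1}, ?_⟩ (fun t w a ha => ?_) (fun t _ W r hr => ?_)
    (lift ℤ (Module.End ℤ (Fin n → ℤ)) φ.ker ρ).toRingHom (fun γ hγ => hρ ?_) ((s + 1) * c)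
    (fun r hr => ?_)
  · refine eq_top_iff.2 fun r _ => submodule_eq_top_of_forall_of_mem _ (fun γ => ?_) r
    rw [← sub_add_cancel (of ℤ _ γ) 1]
    exact add_mem (Submodule.mem_sup_left (hg1 γ))
      (Submodule.mem_sup_right (Submodule.subset_span (by simp)))
  · simpa using (MemWeight.of_mem ha).add ((hσ t w a ha).mono (Nat.le_succ w))
  · rw [groupRingRep_apply, show ∀ a b r : MonoidAlgebra ℤ φ.ker,
      a * b - r = (a - r) * b + r * (b - 1) by intros; noncomm_ring]
    exact ((MemWeight.map_sub_self _ (hσ1 t) (hσ t) hr).mul_right _).add (hr.mul (hg1 _))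
  · rw [map_one, ← hγ]
    simp
  · refine LinearMap.ext fun m => ?_
    have := MemWeight.apply_mem (lift ℤ (Module.End ℤ (Fin n → ℤ)) φ.ker ρ).toRingHom (F := F)
      (fun r i m hm => lift_mem_of_stable ρ (F i) (fun t => hst t i) r hm) (Nat.succ_pos s)
      ?_ ?_ hr c le_rfl 0 m (by simp [h0])
    · rwa [zero_add, hc] at this
    · rintro w hw _ ⟨-, γ, hγ, rfl⟩
      have h2 : (γ : T) ∈ (⊤ : Subgroup T).lowerCentralSeries s :=
        Subgroup.lowerCentralSeries_antitone _ (by omega) hγ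
      rw [hs, Subgroup.mem_bot] at h2
      rw [show γ = 1 from Subtype.ext h2]
      simp
    · rintro w _ ⟨-, γ, -, rfl⟩ i m hm
      simpa using hk γ trivial i m hm

theorem HasNilRep.of_commutator_le [Group.FG φ.ker] (hx : φ x = Multiplicative.ofAdd 1)
    {K : Subgroup T} (hK : K ≤ φ.ker) (hTK : ⁅(⊤ : Subgroup T), ⊤⁆ ≤ K)
    (h : HasNilRep φ.ker (K.subgroupOf φ.ker)) : HasNilRep T K := by
  obtain ⟨n, ρ, hρ, c, F, hF, h0, hc, hst, hk⟩ := h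
  set Θ := lift ℤ (Module.End ℤ (Fin n → ℤ)) φ.ker ρ with hΘ
  let g : ℕ → Set (MonoidAlgebra ℤ φ.ker) := fun w =>
    {a | w = 1 ∧ (Θ a = 0 ∨ ∃ k : φ.ker, (k : T) ∈ K ∧ a = of ℤ _ k - 1)}
  have hg1 : ∀ k : φ.ker, (k : T) ∈ K → MemWeight g 1 (of ℤ φ.ker k - 1) := fun k hk =>
    .of_mem ⟨rfl, .inr ⟨k, hk, rfl⟩⟩
  have hσ1 : ∀ t r, MemWeight g 1 (conjGroupRing φ.ker t r - r) := by
    intro t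
    refine MemWeight.of_forall_of
      ((conjGroupRing φ.ker t).toAddMonoidHom.toIntLinearMap - LinearMap.id) fun γ => ?_
    change MemWeight g 1 (conjGroupRing φ.ker t (of ℤ _ γ) - of ℤ _ γ)
    have : conjGroupRing φ.ker t (of ℤ _ γ) - of ℤ _ γ =
        (of ℤ _ (MulAut.conjNormal t γ * γ⁻¹) - 1) * of ℤ _ γ := by
      rw [sub_mul, ← map_mul, inv_mul_cancel_right, conjGroupRing_of, one_mul]
    rw [this]
    exact (hg1 _ (hTK (Subgroup.commutator_mem_commutator (Subgroup.mem_top t)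
      (Subgroup.mem_top (γ : T))))).mul_right _
  refine HasNilRep.of_memWeight φ hx g (isCofinite_of_linearMap Θ.toLinearMap fun r hr =>
    MemWeight.of_mem ⟨rfl, .inl hr⟩) ?_ (fun k hk W r hr => ?_) Θ.toRingHom
    (fun γ hγ => hρ ?_) c (fun r hr => ?_)
  · rintro t _ a ⟨rfl, ha⟩
    simpa using (MemWeight.of_mem (g := g) ⟨rfl, ha⟩).add (hσ1 t a)
  · rw [show k = ((⟨k, hK hk⟩ : φ.ker) : T) from rfl, groupRingRep_apply_of_mem, ← sub_one_mul,
      add_comm]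
    exact (hg1 _ hk).mul hr
  · rw [map_one, ← hγ]
    simp [hΘ]
  · refine LinearMap.ext fun m => ?_
    have := MemWeight.apply_mem Θ.toRingHom (F := F)
      (fun r i m hm => lift_mem_of_stable ρ (F i) (fun t => hst t i) r hm) one_pos
      ?_ ?_ hr c (one_mul c).le 0 m (by simp [h0])
    · rwa [zero_add, hc] at this
    · rintro w hw _ ⟨rfl, -⟩
      exact absurd hw (lt_irrefl 1)
    · rintro w a ⟨-, ha | ⟨k, hkK, rfl⟩⟩ i m hm
      · simp [show Θ a = 0 from ha]
      · simpa [hΘ] using hk k hkK i m hm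

end Extension

section Coinduced

variable {T M : Type*} [Group T] [AddCommGroup M]

/-- The module coinduced from a representation of a subgroup. -/
def coindModule {N : Subgroup T} (ρ : N →* Module.End ℤ M) : Submodule ℤ (T → M) where
  carrier := {f | ∀ (n : N) t, f (n * t) = ρ n (f t)}
  zero_mem' n t := by simp
  add_mem' hf hg n t := by simp [hf n t, hg n t]
  smul_mem' k f hf n t := by simp [hf n t]

/-- The coinduced representation, acting by right translation. -/
def coindRep {N : Subgroup T} (ρ : N →* Module.End ℤ M) : T →* Module.End ℤ (coindModule ρ) where
  toFun s := LinearMap.restrict (LinearMap.funLeft ℤ M (· * s)) (p := coindModule ρ)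
    (q := coindModule ρ) fun f hf n t => by
      simp only [LinearMap.funLeft_apply, mul_assoc]
      exact hf n (t * s)
  map_one' := by ext f t; simp [LinearMap.restrict_apply, LinearMap.funLeft_apply]
  map_mul' s s' := by
    ext f t
    exact congrArg f.1 (mul_assoc t s s').symm

theorem coindRep_apply {N : Subgroup T} (ρ : N →* Module.End ℤ M) (s : T) (f : coindModule ρ)
    (t : T) : (coindRep ρ s f : T → M) t = (f : T → M) (t * s) := rfl

theorem finite_coindModule {N : Subgroup T} (hN : N.index ≠ 0) [Module.Finite ℤ M]
    (ρ : N →* Module.End ℤ M) : Module.Finite ℤ (coindModule ρ) := by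
  have : N.FiniteIndex := ⟨hN⟩
  refine Module.Finite.of_injective ((LinearMap.funLeft ℤ M
    fun q : T ⧸ N => (q.out : T)⁻¹) ∘ₗ (coindModule ρ).subtype) ?_
  rw [injective_iff_map_eq_zero]
  intro f hf
  ext t
  obtain ⟨n, hn⟩ := QuotientGroup.mk_out_eq_mul N t⁻¹
  have h1 : (f : T → M) ((t⁻¹ * n)⁻¹) = 0 := hn ▸ congrFun hf (t⁻¹ : T)
  have h2 := f.2 n ((t⁻¹ * n)⁻¹)
  rw [h1, map_zero] at h2
  simpa using h2

theorem coindRep_injective {N : Subgroup T} [Nontrivial M] {ρ : N →* Module.End ℤ M}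
    (hρ : Function.Injective ρ) : Function.Injective (coindRep ρ) := by
  classical
  rw [injective_iff_map_eq_one]
  intro s hs
  have key : ∀ m : M, (if h : s ∈ N then ρ ⟨s, h⟩ m else 0) = m := by
    intro m
    let f : coindModule ρ := ⟨fun t => if h : t ∈ N then ρ ⟨t, h⟩ m else 0, fun n t => by
      by_cases h : t ∈ N
      · have h' : (n : T) * t ∈ N := N.mul_mem n.2 h
        simp only [h, h', dif_pos]
        rw [← Module.End.mul_apply, ← map_mul]
        rfl
      · have h' : (n : T) * t ∉ N := fun h' => h ((N.mul_mem_cancel_left n.2).1 h')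
        simp [h, h']⟩
    have h1 := congrFun (congrArg Subtype.val (LinearMap.congr_fun hs f)) 1
    rw [coindRep_apply, one_mul] at h1
    refine h1.trans ?_
    change (if h : (1 : T) ∈ N then ρ ⟨1, h⟩ m else 0) = m
    rw [dif_pos N.one_mem, show (⟨1, N.one_mem⟩ : N) = 1 from rfl, map_one, Module.End.one_apply]
  have hsN : s ∈ N := by
    by_contra h
    obtain ⟨m, hm⟩ := exists_ne (0 : M)
    exact hm (by simpa [h] using (key m).symm)
  refine congrArg Subtype.val (hρ (a₁ := ⟨s, hsN⟩) (a₂ := 1) (LinearMap.ext fun m => ?_))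
  simpa [hsN] using key m

theorem IsNilRep.coindRep {N L : Subgroup T} [hLn : L.Normal] (hLN : L ≤ N)
    {ρ : N →* Module.End ℤ M} (h : IsNilRep (L.subgroupOf N) ρ) : IsNilRep L (coindRep ρ) := by
  obtain ⟨c, F, hF, h0, hc, hst, hk⟩ := h
  refine ⟨c, fun i => (Submodule.pi Set.univ fun _ => F i).comap (coindModule ρ).subtype,
    fun i j hij f hf t ht => hF hij (hf t ht), ?_, ?_, fun s i f hf t _ => hf (t * s) trivial,
    fun k hkL i f hf t _ => ?_⟩
  · rw [eq_top_iff]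
    intro f _ t _
    simp [h0]
  · rw [eq_bot_iff]
    intro f hf
    ext t
    simpa [hc] using hf t trivial
  · have hk' : t * k * t⁻¹ ∈ L := hLn.conj_mem k hkL t
    have h1 := hk ⟨_, hLN hk'⟩ hk' i _ (hf t trivial)
    have h2 := f.2 ⟨_, hLN hk'⟩ t
    simp only [inv_mul_cancel_right] at h2
    change (f : T → M) (t * k) - (f : T → M) t ∈ F (i + 1)
    rw [h2]
    exact h1

theorem isNilRep_one (L : Subgroup T) : IsNilRep L (1 : T →* Module.End ℤ M) := by
  refine ⟨1, fun i => if i = 0 then ⊤ else ⊥, ?_, by simp, by simp, by simp, by simp⟩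
  refine antitone_nat_of_succ_le fun i => by simp

theorem HasNilRep.of_index_ne_zero {N L : Subgroup T} [L.Normal] (hLN : L ≤ N) (hN : N.index ≠ 0)
    (h : HasNilRep N (L.subgroupOf N)) : HasNilRep T L := by
  obtain ⟨n, ρ, hρ, hnil⟩ := h
  let ρ' := prodRep ρ (1 : N →* Module.End ℤ ℤ)
  have hρ' : Function.Injective ρ' := fun a b hab => hρ <| LinearMap.ext fun m =>
    congrArg Prod.fst (LinearMap.congr_fun hab (m, 0))
  have : Module.Finite ℤ (coindModule ρ') := finite_coindModule hN ρ'
  have : Module.Free ℤ (coindModule ρ') := Module.free_of_finite_type_torsion_free'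
  exact HasNilRep.of_rep _ (coindRep_injective hρ') ((hnil.prod (isNilRep_one _)).coindRep hLN)

end Coinduced

theorem HasNilRep.of_isNilpotent_of_polyZ {n : ℕ} {Γ : Type*} [Group Γ] (h : PolyZ n Γ)
    (hΓ : Group.IsNilpotent Γ) : HasNilRep Γ ⊤ := by
  induction n generalizing Γ with
  | zero =>
    have : Subsingleton Γ := h
    exact ⟨0, 1, Function.injective_of_subsingleton _, isNilRep_one _⟩
  | succ n ih =>
    obtain ⟨φ, hφ⟩ := h
    have hker := ih hφ inferInstance
    have : IsCyclic (Γ ⧸ φ.ker) :=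
      isCyclic_of_injective (QuotientGroup.kerLift φ) (QuotientGroup.kerLift_injective φ)
    rcases finite_or_infinite (Γ ⧸ φ.ker) with hfin | hinf
    · have hφ1 : ∀ g, g ∈ φ.ker := by
        intro g
        obtain ⟨k, hk, hk'⟩ := (isOfFinOrder_of_finite (g : Γ ⧸ φ.ker)).exists_pow_eq_one
        rw [← QuotientGroup.mk_pow, QuotientGroup.eq_one_iff, MonoidHom.mem_ker, map_pow] at hk'
        exact MonoidHom.mem_ker.2 ((pow_eq_one_iff_left hk.ne').1 hk')
      exact hker.comap ((MonoidHom.id Γ).codRestrict φ.ker hφ1)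
        (fun a b hab => congrArg Subtype.val hab) le_top
    · obtain ⟨ψ, hψ, x, hx⟩ := φ.ker.exists_ker_eq_of_isCyclic_quotient
      rw [← hψ] at hφ hker
      have := hφ.fg
      exact HasNilRep.of_isNilpotent ψ hx hΓ hker

theorem HasNilRep.of_isCyclic_quotient {T : Type*} [Group T] {N K : Subgroup T} [N.Normal]
    [IsCyclic (T ⧸ N)] (hN : Group.FG N) (hKN : K ≤ N) (hTK : ⁅(⊤ : Subgroup T), ⊤⁆ ≤ K)
    (h : HasNilRep N (K.subgroupOf N)) : HasNilRep T K := by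
  rcases finite_or_infinite (T ⧸ N) with hfin | hinf
  · have : K.Normal := .of_commutator_le _ hTK
    exact h.of_index_ne_zero hKN Subgroup.index_ne_zero_of_finite
  · obtain ⟨φ, rfl, x, hx⟩ := N.exists_ker_eq_of_isCyclic_quotient
    exact h.of_commutator_le φ hx hKN hTK

theorem HasNilRep.of_commutator_le_of_polyZ {n : ℕ} {Γ : Type*} [Group Γ] (h : PolyZ n Γ)
    {K : Subgroup Γ} (hΓ : ⁅(⊤ : Subgroup Γ), ⊤⁆ ≤ K) (hK : HasNilRep K ⊤) : HasNilRep Γ K := by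
  classical
  have hfg : ∀ H : Subgroup Γ, Group.FG H := fun H => (h.of_injective _ H.subtype_injective).fg
  have hnormal : ∀ H : Subgroup Γ, K ≤ H → H.Normal := fun H hH =>
    Subgroup.Normal.of_commutator_le _ (hΓ.trans hH)
  have key : ∀ X : Finset Γ, ∀ H : Subgroup Γ, H = K ⊔ Subgroup.closure X →
      HasNilRep H (K.subgroupOf H) := by
    intro X
    induction X using Finset.induction with
    | empty =>
      rintro H hH
      exact hK.comap (Subgroup.inclusion (by simp [hH])) (Subgroup.inclusion_injective _) le_top
    | insert x X _ ih =>
      rintro H hH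
      set N := K ⊔ Subgroup.closure (X : Set Γ) with hNdef
      have hHN : H = N ⊔ Subgroup.zpowers x := by
        rw [hH, Finset.coe_insert, Set.insert_eq, Subgroup.closure_union,
          ← Subgroup.zpowers_eq_closure, hNdef, sup_assoc, sup_comm (Subgroup.zpowers x)]
      have hNH : N ≤ H := hHN.ge.trans' le_sup_left
      have hKN : K ≤ N := le_sup_left
      have hNn : N.Normal := hnormal N hKN
      have hcyc : IsCyclic (H ⧸ N.subgroupOf H) := by
        have hxH : x ∈ H := hHN.ge (Subgroup.mem_sup_right (Subgroup.mem_zpowers x))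
        refine ⟨((⟨x, hxH⟩ : H) : H ⧸ N.subgroupOf H), fun q => ?_⟩
        obtain ⟨⟨g, hg⟩, rfl⟩ := QuotientGroup.mk_surjective q
        obtain ⟨a, ha, _, ⟨j, rfl⟩, rfl⟩ := Subgroup.mem_sup_of_normal_left.1 (hHN.le hg)
        refine ⟨j, ?_⟩
        change (((⟨x, hxH⟩ : H) ^ j : H) : H ⧸ N.subgroupOf H) = _
        rw [QuotientGroup.eq, Subgroup.mem_subgroupOf]
        simpa using (hNn.mem_comm_iff.1 (by simpa [mul_assoc] using ha))
      refine HasNilRep.of_isCyclic_quotient (N := N.subgroupOf H) ?_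
        (Subgroup.comap_mono hKN) ?_ ?_
      · exact (h.of_injective (H.subtype.comp (N.subgroupOf H).subtype)
          (H.subtype_injective.comp (Subgroup.subtype_injective _))).fg
      · rw [Subgroup.subgroupOf, ← Subgroup.map_le_iff_le_comap, Subgroup.map_commutator]
        exact (Subgroup.commutator_mono le_top le_top).trans hΓ
      · refine (ih N rfl).comap (Subgroup.subgroupOfEquivOfLe hNH).toMonoidHom
          (MulEquiv.injective _) ?_
        rintro _ ⟨g, hg, rfl⟩
        exact hg
  obtain ⟨X, hX⟩ := h.fg.out
  exact (key X ⊤ (by rw [hX, sup_top_eq])).comap Subgroup.topEquiv.symm.toMonoidHom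
    (MulEquiv.injective _) (by rintro _ ⟨g, hg, rfl⟩; exact hg)

theorem HasNilRep.of_virtuallyPolyZ {G : Type*} [Group G] (h : VirtuallyPolyZ G) :
    HasNilRep G ⊥ := by
  obtain ⟨n, P, hP, hPn⟩ := h
  obtain ⟨H, hH, hnil⟩ := hPn.exists_isNilpotent_commutator
  have hHn := hPn.of_injective _ H.subtype_injective
  let e : (⁅(⊤ : Subgroup H), ⊤⁆ : Subgroup H) →* (⁅H, H⁆ : Subgroup P) :=
    (H.subtype.comp (Subgroup.subtype _)).codRestrict _ fun g =>
      H.map_subtype_commutator ▸ Subgroup.mem_map_of_mem _ g.2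
  have he : Function.Injective e := fun a b hab =>
    Subtype.ext (Subtype.ext (congrArg (Subtype.val : (⁅H, H⁆ : Subgroup P) → P) hab))
  have h1 : HasNilRep H ⁅(⊤ : Subgroup H), ⊤⁆ := .of_commutator_le_of_polyZ hHn le_rfl
    (.of_isNilpotent_of_polyZ (hHn.of_injective _ (Subgroup.subtype_injective _))
      (Subgroup.isNilpotent_of_ker_le_center e (by simp [(MonoidHom.ker_eq_bot_iff e).2 he])))
  have h2 : HasNilRep P ⊥ := (h1.mono (by simp)).of_index_ne_zero bot_le hH
  exact (h2.mono (by simp)).of_index_ne_zero bot_le hP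

/-- Every polycyclic group embeds in `GL(n,ℤ)` for some `n`: if `G` admits a finite series
`1 = G₁ ⊴ G₂ ⊴ ⋯ ⊴ G_{k+1} = G` in which each `Gᵢ` is normal in `G_{i+1}` and each
quotient `G_{i+1}/Gᵢ` is cyclic, then there is an injective group homomorphism
`G → GL(n,ℤ)` for some `n`. -/
theorem polycyclic_embeds_in_GL_int {G : Type*} [Group G]
    (hpoly : ∃ (k : ℕ) (s : Fin (k + 1) → Subgroup G),
      s 0 = ⊥ ∧ s (Fin.last k) = ⊤ ∧
      ∀ i : Fin k,
        s i.castSucc ≤ s i.succ ∧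
        ∃ _ : ((s i.castSucc).subgroupOf (s i.succ)).Normal,
          IsCyclic (↥(s i.succ) ⧸ (s i.castSucc).subgroupOf (s i.succ))) :
    ∃ (n : ℕ) (f : G →* GL (Fin n) ℤ), Function.Injective f := by
  obtain ⟨n, ρ, hρ, -⟩ := HasNilRep.of_virtuallyPolyZ (virtuallyPolyZ_of_series hpoly)
  let f : G →* Matrix (Fin n) (Fin n) ℤ :=
    (LinearMap.toMatrixAlgEquiv' : _ ≃ₐ[ℤ] Matrix (Fin n) (Fin n) ℤ).toMonoidHom.comp ρ
  exact ⟨n, f.toHomUnits, fun a b hab => hρ <| LinearMap.toMatrixAlgEquiv'.injective <|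
    congrArg Units.val hab⟩
end
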